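/- arXiv:2504.08335 — 2 statements merged into one kernel-verified Lean document; each statement's English description precedes it below -/
import Mathlib

section
/- Let G ~ N_d(0,K) be independent of A. Then, for every integer k ≥ 1 and every t ∈ [0,1], almost surely on the event E := {‖A−K‖_op ≤ λ(K)/2} one has E[ (∂^k g/∂t^k)(A,t,G) | A ] = 0. -/
open MeasureTheory ProbabilityTheory Matrix

noncomputable section

/-- Euclidean norm on `Fin d → ℝ`. -/
def euclNorm {d : ℕ} (x : Fin d → ℝ) : ℝ := Real.sqrt (∑ i, x i ^ 2)

/-- Hilbert–Schmidt norm of a matrix. -/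
def hsNorm {d : ℕ} (M : Matrix (Fin d) (Fin d) ℝ) : ℝ := Real.sqrt (∑ i, ∑ j, M i j ^ 2)

/-- Operator norm of a matrix (w.r.t. the Euclidean norm). -/
def opNorm {d : ℕ} (M : Matrix (Fin d) (Fin d) ℝ) : ℝ :=
  sSup {r : ℝ | ∃ x : Fin d → ℝ, euclNorm x = 1 ∧ r = euclNorm (M.mulVec x)}

/-- Smallest eigenvalue of a symmetric matrix (as the infimum of the Rayleigh quotient). -/
def lambdaMin {d : ℕ} (M : Matrix (Fin d) (Fin d) ℝ) : ℝ :=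
  sInf {r : ℝ | ∃ x : Fin d → ℝ, euclNorm x = 1 ∧ r = x ⬝ᵥ M.mulVec x}

/-- Density of the centered Gaussian law `N_d(0, M)` on `ℝ^d`. -/
def gaussDensity {d : ℕ} (M : Matrix (Fin d) (Fin d) ℝ) (x : Fin d → ℝ) : ℝ :=
  (Real.sqrt ((2 * Real.pi) ^ d * M.det))⁻¹ * Real.exp (-(1/2) * (x ⬝ᵥ M⁻¹.mulVec x))

/-- The centered Gaussian law `N_d(0, M)` on `ℝ^d` (for `M` positive definite). -/
def gaussLaw {d : ℕ} (M : Matrix (Fin d) (Fin d) ℝ) : Measure (Fin d → ℝ) :=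
  volume.withDensity fun x => ENNReal.ofReal (gaussDensity M x)

/-- Relative entropy (Kullback–Leibler divergence) of `μ` with respect to `ν`. -/
def relEnt {E : Type*} [MeasurableSpace E] (μ ν : Measure E) : ℝ :=
  ∫ x, Real.log ((μ.rnDeriv ν x).toReal) ∂μ

/-- `F` is a centered, integrable random vector which is conditionally Gaussian with respect to
the σ-field `𝓕`, with conditional covariance matrix `A`. -/
def CondGaussian {Ω : Type*} [MeasurableSpace Ω] (P : Measure Ω) {d : ℕ}
    (F : Ω → Fin d → ℝ) (𝓕 : MeasurableSpace Ω)
    (A : Ω → Matrix (Fin d) (Fin d) ℝ) : Prop :=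
  Integrable F P ∧ (∫ ω, F ω ∂P) = 0 ∧
  (∀ ω, (A ω).PosSemidef) ∧
  Measurable[𝓕] (fun ω i j => A ω i j) ∧
  ∀ y : Fin d → ℝ,
    P[(fun ω => Complex.exp (Complex.I * ((y ⬝ᵥ F ω : ℝ) : ℂ))) | 𝓕] =ᵐ[P]
      fun ω => ((Real.exp (-(1/2) * (y ⬝ᵥ (A ω).mulVec y)) : ℝ) : ℂ)

/-- The dimensional constant `2√6 + 3√2 + 2 + √d`. -/
def Cfac (d : ℕ) : ℝ := 2 * Real.sqrt 6 + 3 * Real.sqrt 2 + 2 + Real.sqrt d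

/-- `max{ |log(2^d det K/(2‖K‖_op + λ(K))^d)| , log(2^d det K/λ(K)^d) }`. -/
def maxLog {d : ℕ} (K : Matrix (Fin d) (Fin d) ℝ) : ℝ :=
  max |Real.log ((2 ^ d * K.det) / ((2 * opNorm K + lambdaMin K) ^ d))|
      (Real.log ((2 ^ d * K.det) / (lambdaMin K ^ d)))


/-- The event `E = {‖A − K‖_op ≤ λ(K)/2}`. -/
def EvSet {Ω : Type*} {d : ℕ} (A : Ω → Matrix (Fin d) (Fin d) ℝ)
    (K : Matrix (Fin d) (Fin d) ℝ) : Set Ω :=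
  {ω | opNorm (A ω - K) ≤ lambdaMin K / 2}


/-- The interpolating matrix `Γ_t = tA + (1−t)K`. -/
def Gam {d : ℕ} (A K : Matrix (Fin d) (Fin d) ℝ) (t : ℝ) : Matrix (Fin d) (Fin d) ℝ :=
  t • A + (1 - t) • K

/-- The interpolating density ratio `g(A,t,x) = φ_{Γ_t}(x)/φ_K(x)`. -/
def gfun {d : ℕ} (A K : Matrix (Fin d) (Fin d) ℝ) (t : ℝ) (x : Fin d → ℝ) : ℝ :=
  gaussDensity (Gam A K t) x / gaussDensity K x

/-- `h_k(A,t,x) = (∂^k g/∂t^k)(A,t,x) / g(A,t,x)`. -/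
def hfun {d : ℕ} (k : ℕ) (A K : Matrix (Fin d) (Fin d) ℝ) (t : ℝ) (x : Fin d → ℝ) : ℝ :=
  iteratedDeriv k (fun s => gfun A K s x) t / gfun A K t x

/-- `g̃(A,t,x) = E[φ_{Γ_t}(x) 1_E] / (P(E) φ_K(x))`. -/
def gtilde {Ω : Type*} [MeasurableSpace Ω] (P : Measure Ω) {d : ℕ}
    (A : Ω → Matrix (Fin d) (Fin d) ℝ) (K : Matrix (Fin d) (Fin d) ℝ)
    (t : ℝ) (x : Fin d → ℝ) : ℝ :=
  (∫ ω in EvSet A K, gaussDensity (Gam (A ω) K t) x ∂P) /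
    ((P (EvSet A K)).toReal * gaussDensity K x)

end
noncomputable section helpers
open Filter Topology
open scoped ContDiff

/-- quadratic form with coefficients depending on `s` -/
def qf9 {d : ℕ} (B : Fin d → Fin d → ℝ → ℝ) (s : ℝ) (x : Fin d → ℝ) : ℝ :=
  ∑ i, ∑ j, B i j s * (x i * x j)

inductive GoodF9 {d : ℕ} (I : Set ℝ) (B : Fin d → Fin d → ℝ → ℝ) :
    (ℝ → (Fin d → ℝ) → ℝ) → Prop
  | base (c : ℝ → ℝ) (p : (Fin d → ℝ) → ℝ) (hc : ContDiffOn ℝ ∞ c I) (hp : Continuous p)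
      (hp' : ∀ b : ℝ, 0 < b → ∃ C : ℝ, ∀ x, |p x| ≤ C * Real.exp (b * ‖x‖ ^ 2)) :
      GoodF9 I B (fun s x => c s * p x * Real.exp (-(1/2) * qf9 B s x))
  | add (F G : ℝ → (Fin d → ℝ) → ℝ) (hF : GoodF9 I B F) (hG : GoodF9 I B G) :
      GoodF9 I B (fun s x => F s x + G s x)

theorem qf9_continuous {d : ℕ} (B : Fin d → Fin d → ℝ → ℝ) (s : ℝ) : Continuous (qf9 B s) := by
  unfold qf9
  fun_prop

theorem GoodF9.sum {d : ℕ} {I : Set ℝ} {B : Fin d → Fin d → ℝ → ℝ} {ι : Type*} (S : Finset ι)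
    (F : ι → ℝ → (Fin d → ℝ) → ℝ) (h : ∀ i ∈ S, GoodF9 I B (F i)) :
    GoodF9 I B (fun s x => ∑ i ∈ S, F i s x) := by
  classical
  induction S using Finset.induction_on with
  | empty =>
    have := GoodF9.base (I := I) (B := B) (fun _ => 0) (fun _ => 0) contDiffOn_const
      continuous_const (fun b _ => ⟨0, fun x => by simp⟩)
    simpa using this
  | insert a S ha ih =>
    have := GoodF9.add _ _ (h a (Finset.mem_insert_self _ _))
      (ih (fun i hi => h i (Finset.mem_insert_of_mem hi)))
    simpa [Finset.sum_insert ha] using this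

theorem GoodF9.cont {d : ℕ} {I : Set ℝ} {B : Fin d → Fin d → ℝ → ℝ}
    {F : ℝ → (Fin d → ℝ) → ℝ} (h : GoodF9 I B F) (s : ℝ) : Continuous (F s) := by
  induction h with
  | base c p hc hp hp' =>
    have := qf9_continuous B s
    fun_prop
  | add F G _ _ h1 h2 => exact h1.add h2

theorem GoodF9.deriv {d : ℕ} {I : Set ℝ} (hI : IsOpen I) {B : Fin d → Fin d → ℝ → ℝ}
    (hB : ∀ i j, ContDiffOn ℝ ∞ (B i j) I)
    {F : ℝ → (Fin d → ℝ) → ℝ} (h : GoodF9 I B F) :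
    ∃ F', GoodF9 I B F' ∧ ∀ s ∈ I, ∀ x, HasDerivAt (fun u => F u x) (F' s x) s := by
  have key : ∀ c : ℝ → ℝ, ContDiffOn ℝ ∞ c I → ∀ s ∈ I, HasDerivAt c (_root_.deriv c s) s := by
    intro c hc s hs
    exact ((hc.contDiffAt (hI.mem_nhds hs)).differentiableAt (by simp)).hasDerivAt
  induction h with
  | base c p hc hp hp' =>
    refine ⟨fun s x => (_root_.deriv c s * p x * Real.exp (-(1/2) * qf9 B s x)) +
      ∑ i, ∑ j, (c s * (-(1/2) * _root_.deriv (B i j) s)) * (p x * (x i * x j)) *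
        Real.exp (-(1/2) * qf9 B s x), ?_, ?_⟩
    · refine GoodF9.add _ _ (GoodF9.base _ _ (hc.deriv_of_isOpen hI (by simp)) hp hp') ?_
      refine GoodF9.sum _ _ fun i _ => GoodF9.sum _ _ fun j _ => ?_
      refine GoodF9.base (fun s => c s * (-(1/2) * _root_.deriv (B i j) s))
        (fun x => p x * (x i * x j)) ?_ (by fun_prop) ?_
      · exact hc.mul (contDiffOn_const.mul ((hB i j).deriv_of_isOpen hI (by simp)))
      · intro b hb
        obtain ⟨C, hC⟩ := hp' (b/2) (by positivity)
        refine ⟨C * (2 / b), fun x => ?_⟩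
        have h1 : |x i * x j| ≤ ‖x‖ ^ 2 := by
          rw [abs_mul, sq]
          exact mul_le_mul (norm_le_pi_norm x i) (norm_le_pi_norm x j) (abs_nonneg _) (norm_nonneg _)
        have h2 : ‖x‖ ^ 2 ≤ (2 / b) * Real.exp (b/2 * ‖x‖ ^ 2) := by
          have := Real.add_one_le_exp (b/2 * ‖x‖ ^ 2)
          have h3 : b/2 * ‖x‖ ^ 2 ≤ Real.exp (b/2 * ‖x‖ ^ 2) := by linarith
          calc ‖x‖ ^ 2 = (2/b) * (b/2 * ‖x‖ ^ 2) := by field_simp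
            _ ≤ _ := by gcongr
        have hx := hC x
        calc |p x * (x i * x j)| = |p x| * |x i * x j| := abs_mul _ _
          _ ≤ (C * Real.exp (b/2 * ‖x‖ ^ 2)) * ((2 / b) * Real.exp (b/2 * ‖x‖ ^ 2)) :=
            mul_le_mul hx (h1.trans h2) (abs_nonneg _) ((abs_nonneg _).trans hx)
          _ = C * (2/b) * (Real.exp (b/2 * ‖x‖ ^ 2) * Real.exp (b/2 * ‖x‖ ^ 2)) := by ring
          _ = _ := by rw [← Real.exp_add]; congr 2; ring
    · intro s hs x
      have hq : HasDerivAt (fun u => qf9 B u x)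
          (∑ i, ∑ j, _root_.deriv (B i j) s * (x i * x j)) s := by
        unfold qf9
        refine HasDerivAt.fun_sum fun i _ => HasDerivAt.fun_sum fun j _ => ?_
        exact (key _ (hB i j) s hs).mul_const _
      have := ((key c hc s hs).mul_const (p x)).mul (hq.const_mul (-(1/2))).exp
      convert! this using 1
      simp only [Finset.mul_sum]
      congr 1
      refine Finset.sum_congr rfl fun i _ => Finset.sum_congr rfl fun j _ => ?_
      ring
  | add F G _ _ h1 h2 =>
    obtain ⟨F', h1, h1'⟩ := h1
    obtain ⟨G', h2, h2'⟩ := h2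
    exact ⟨_, GoodF9.add _ _ h1 h2, fun s hs x => (h1' s hs x).add (h2' s hs x)⟩

theorem GoodF9.bound {d : ℕ} {I : Set ℝ} (hI : IsOpen I) {B : Fin d → Fin d → ℝ → ℝ}
    {b : ℝ} (hb : 0 < b) (hQ : ∀ s ∈ I, ∀ x, b * ‖x‖ ^ 2 ≤ qf9 B s x)
    {F : ℝ → (Fin d → ℝ) → ℝ} (h : GoodF9 I B F) (s : ℝ) (hs : s ∈ I) :
    ∃ C : ℝ, ∀ᶠ u in 𝓝 s, ∀ x, |F u x| ≤ C * Real.exp (-(b/4) * ‖x‖ ^ 2) := by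
  induction h with
  | base c p hc hp hp' =>
    obtain ⟨C, hC⟩ := hp' (b/4) (by positivity)
    have hcc : ContinuousAt c s := hc.continuousOn.continuousAt (hI.mem_nhds hs)
    refine ⟨(|c s| + 1) * C, ?_⟩
    have h1 : ∀ᶠ u in 𝓝 s, |c u| < |c s| + 1 := hcc.abs.eventually_lt_const (by linarith)
    filter_upwards [h1, hI.mem_nhds hs] with u hu huI x
    have h2 : Real.exp (-(1/2) * qf9 B u x) ≤ Real.exp (-(b/2) * ‖x‖ ^ 2) := by
      apply Real.exp_le_exp.2
      have := hQ u huI x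
      linarith
    rw [abs_mul, abs_mul, Real.abs_exp]
    calc |c u| * |p x| * Real.exp (-(1/2) * qf9 B u x)
        ≤ (|c s| + 1) * (C * Real.exp (b/4 * ‖x‖ ^ 2)) * Real.exp (-(b/2) * ‖x‖ ^ 2) := by
          have := (abs_nonneg _).trans (hC x)
          gcongr
          exact hC x
      _ = (|c s| + 1) * C * (Real.exp (b/4 * ‖x‖ ^ 2) * Real.exp (-(b/2) * ‖x‖ ^ 2)) := by ring
      _ = _ := by rw [← Real.exp_add]; congr 2; ring
  | add F G _ _ h1 h2 =>
    obtain ⟨C, h1⟩ := h1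
    obtain ⟨C', h2⟩ := h2
    refine ⟨C + C', ?_⟩
    filter_upwards [h1, h2] with u h1 h2 x
    rw [add_mul]
    exact (abs_add_le _ _).trans (add_le_add (h1 x) (h2 x))

theorem integrable_exp_norm9 {d : ℕ} {b : ℝ} (hb : 0 < b) :
    Integrable (fun x : Fin d → ℝ => Real.exp (-b * ‖x‖ ^ 2)) := by
  have h0 : Integrable (fun x : Fin d → ℝ => ∏ i, Real.exp (-(b / (d + 1)) * x i ^ 2)) :=
    Integrable.fintype_prod (f := fun (i : Fin d) (y : ℝ) => Real.exp (-(b / (d + 1)) * y ^ 2))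
      (fun i => integrable_exp_neg_mul_sq (by positivity))
  refine h0.mono' (by fun_prop) (ae_of_all _ fun x => ?_)
  rw [Real.norm_eq_abs, Real.abs_exp, ← Real.exp_sum]
  apply Real.exp_le_exp.2
  rw [← Finset.mul_sum]
  have : ∑ i, x i ^ 2 ≤ (d + 1) * ‖x‖ ^ 2 := by
    calc ∑ i, x i ^ 2 ≤ ∑ i : Fin d, ‖x‖ ^ 2 := by
          refine Finset.sum_le_sum fun i _ => ?_
          rw [← sq_abs]
          have := norm_le_pi_norm x i
          rw [Real.norm_eq_abs] at this
          gcongr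
      _ = d * ‖x‖ ^ 2 := by simp
      _ ≤ _ := by nlinarith [sq_nonneg ‖x‖]
  have h2 : b / (d + 1) * ∑ i, x i ^ 2 ≤ b / (d+1) * ((d + 1) * ‖x‖ ^ 2) := by gcongr
  have h3 : b / (d+1) * ((d + 1) * ‖x‖ ^ 2) = b * ‖x‖ ^ 2 := by field_simp
  linarith

theorem GoodF9.iter {d : ℕ} {I : Set ℝ} (hI : IsOpen I) {B : Fin d → Fin d → ℝ → ℝ}
    (hB : ∀ i j, ContDiffOn ℝ ∞ (B i j) I)
    {b : ℝ} (hb : 0 < b) (hQ : ∀ s ∈ I, ∀ x, b * ‖x‖ ^ 2 ≤ qf9 B s x)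
    {F : ℝ → (Fin d → ℝ) → ℝ} (h : GoodF9 I B F) (k : ℕ) :
    ∃ F', GoodF9 I B F' ∧ ∀ s ∈ I, (∀ x, iteratedDeriv k (fun u => F u x) s = F' s x) ∧
      iteratedDeriv k (fun u => ∫ x, F u x) s = ∫ x, F' s x := by
  induction k with
  | zero => exact ⟨F, h, fun s hs => ⟨fun x => by simp, by simp⟩⟩
  | succ k ih =>
    obtain ⟨F₁, h₁, h₁'⟩ := ih
    obtain ⟨F₂, h₂, h₂'⟩ := h₁.deriv hI hB
    refine ⟨F₂, h₂, fun s hs => ⟨fun x => ?_, ?_⟩⟩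
    · rw [iteratedDeriv_succ]
      have : iteratedDeriv k (fun u => F u x) =ᶠ[𝓝 s] fun u => F₁ u x := by
        filter_upwards [hI.mem_nhds hs] with u hu using (h₁' u hu).1 x
      rw [this.deriv_eq]
      exact (h₂' s hs x).deriv
    · rw [iteratedDeriv_succ]
      have : iteratedDeriv k (fun u => ∫ x, F u x) =ᶠ[𝓝 s] fun u => ∫ x, F₁ u x := by
        filter_upwards [hI.mem_nhds hs] with u hu using (h₁' u hu).2
      rw [this.deriv_eq]
      obtain ⟨C, hC⟩ := h₂.bound hI hb hQ s hs
      obtain ⟨C₁, hC₁⟩ := h₁.bound hI hb hQ s hs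
      have hb4 : 0 < b / 4 := by positivity
      refine (hasDerivAt_integral_of_dominated_loc_of_deriv_le
        (bound := fun x => C * Real.exp (-(b/4) * ‖x‖ ^ 2))
        (s := {u | u ∈ I ∧ ∀ x, |F₂ u x| ≤ C * Real.exp (-(b/4) * ‖x‖ ^ 2)})
        (F' := F₂) ?_ ?_ ?_ ?_ ?_ ?_ ?_).2.deriv
      · exact (eventually_mem_set.2 (hI.mem_nhds hs)).and hC
      · exact Eventually.of_forall fun u => (h₁.cont u).aestronglyMeasurable
      · refine ((integrable_exp_norm9 hb4).const_mul C₁).mono'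
          (h₁.cont s).aestronglyMeasurable (ae_of_all _ fun x => ?_)
        exact hC₁.self_of_nhds x
      · exact (h₂.cont s).aestronglyMeasurable
      · exact ae_of_all _ fun x u hu => hu.2 x
      · exact (integrable_exp_norm9 hb4).const_mul C
      · exact ae_of_all _ fun x u hu => h₂' u hu.1 x

theorem integral_gaussDensity9 {d : ℕ} (M : Matrix (Fin d) (Fin d) ℝ) (hM : M.PosDef) :
    ∫ x, gaussDensity M x = 1 := by
  obtain ⟨C, hC⟩ : ∃ C : Matrix (Fin d) (Fin d) ℝ, M⁻¹ = Cᵀ * C := by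
    open scoped MatrixOrder in
    have h := CStarAlgebra.nonneg_iff_eq_star_mul_self.1
      (Matrix.nonneg_iff_posSemidef.2 hM.inv.posSemidef)
    obtain ⟨C, hC⟩ := h
    exact ⟨C, by rw [hC, Matrix.star_eq_conjTranspose, Matrix.conjTranspose_eq_transpose_of_trivial]⟩
  have hdM := hM.det_pos
  have hdet : M.det⁻¹ = C.det ^ 2 := by
    have := congrArg Matrix.det hC
    rw [Matrix.det_nonsing_inv, Ring.inverse_eq_inv', Matrix.det_mul, Matrix.det_transpose] at this
    rw [this, sq]
  have hCdet : C.det ≠ 0 := by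
    intro h
    rw [h] at hdet
    simp at hdet
    exact hdM.ne' hdet
  have hq : ∀ x : Fin d → ℝ, x ⬝ᵥ M⁻¹.mulVec x = ∑ i, (Matrix.toLin' C x) i ^ 2 := by
    intro x
    rw [hC, ← Matrix.mulVec_mulVec, Matrix.dotProduct_mulVec, Matrix.vecMul_transpose]
    simp [dotProduct, sq]
  let f : (Fin d → ℝ) → ℝ := fun y => ∏ i, Real.exp (-(1/2) * y i ^ 2)
  have hf : Continuous f := by fun_prop
  have h1 : ∀ x, Real.exp (-(1/2) * (x ⬝ᵥ M⁻¹.mulVec x)) = f (Matrix.toLin' C x) := by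
    intro x
    simp only [f]
    rw [hq, ← Real.exp_sum, Finset.mul_sum]
  have hmeas : Measurable (Matrix.toLin' C) :=
    (LinearMap.continuous_of_finiteDimensional _).measurable
  have h2 : ∫ x, f (Matrix.toLin' C x) = |C.det|⁻¹ * (√(2 * Real.pi)) ^ d := by
    rw [← integral_map (μ := volume) hmeas.aemeasurable hf.aestronglyMeasurable,
      Real.map_matrix_volume_pi_eq_smul_volume_pi hCdet, integral_smul_measure,
      integral_fintype_prod_volume_eq_pow (fun y : ℝ => Real.exp (-(1/2) * y ^ 2)),
      integral_gaussian]
    rw [ENNReal.toReal_ofReal (abs_nonneg _), abs_inv, smul_eq_mul, Fintype.card_fin]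
    congr 3
    field_simp
  unfold gaussDensity
  rw [integral_const_mul]
  simp_rw [h1]
  rw [h2]
  have h3 : √((2 * Real.pi) ^ d * M.det) = √(2 * Real.pi) ^ d * |C.det|⁻¹ := by
    rw [Real.sqrt_mul (by positivity)]
    congr 1
    · rw [Real.sqrt_eq_iff_mul_self_eq (by positivity) (by positivity), ← mul_pow,
        Real.mul_self_sqrt (by positivity)]
    · rw [← abs_inv, ← Real.sqrt_sq_eq_abs, inv_pow, ← hdet, inv_inv]
  rw [h3, mul_comm (|C.det|⁻¹)]
  exact inv_mul_cancel₀ (by positivity)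

theorem contDiff_det9 {d : ℕ} {M : ℝ → Matrix (Fin d) (Fin d) ℝ}
    (h : ∀ i j, ContDiff ℝ ∞ (fun s => M s i j)) : ContDiff ℝ ∞ (fun s => (M s).det) := by
  simp only [Matrix.det_apply, Units.smul_def, zsmul_eq_mul]
  refine ContDiff.sum fun σ _ => contDiff_const.mul (contDiff_prod fun i _ => h _ _)

theorem contDiff_Gam9 {d : ℕ} (A K : Matrix (Fin d) (Fin d) ℝ) (i j) :
    ContDiff ℝ ∞ (fun s => Gam A K s i j) := by
  simp only [Gam, Matrix.add_apply, Matrix.smul_apply, smul_eq_mul]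
  fun_prop

theorem contDiff_Gamdet9 {d : ℕ} (A K : Matrix (Fin d) (Fin d) ℝ) :
    ContDiff ℝ ∞ (fun s => (Gam A K s).det) := contDiff_det9 (contDiff_Gam9 A K)

theorem contDiffOn_inv9 {d : ℕ} (A K : Matrix (Fin d) (Fin d) ℝ) (i j) :
    ContDiffOn ℝ ∞ (fun s => (Gam A K s)⁻¹ i j) {s | 0 < (Gam A K s).det} := by
  simp only [Matrix.inv_def, Ring.inverse_eq_inv', Matrix.smul_apply, smul_eq_mul,
    Matrix.adjugate_apply]
  refine ((contDiff_Gamdet9 A K).contDiffOn.inv fun s hs => (ne_of_gt hs)).mul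
    (ContDiff.contDiffOn ?_)
  refine contDiff_det9 fun i' j' => ?_
  simp only [Matrix.updateRow_apply]
  split_ifs
  · exact contDiff_const
  · exact contDiff_Gam9 A K _ _

theorem contDiffOn_c9 {d : ℕ} (A K : Matrix (Fin d) (Fin d) ℝ) :
    ContDiffOn ℝ ∞ (fun s => (√((2 * Real.pi) ^ d * (Gam A K s).det))⁻¹)
      {s | 0 < (Gam A K s).det} := by
  have hpos : ∀ s ∈ {s | 0 < (Gam A K s).det}, 0 < (2 * Real.pi) ^ d * (Gam A K s).det := by
    intro s hs
    have : 0 < (Gam A K s).det := hs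
    positivity
  refine ContDiffOn.inv (ContDiffOn.sqrt ?_ fun s hs => (hpos s hs).ne') fun s hs =>
    (Real.sqrt_pos.2 (hpos s hs)).ne'
  exact (contDiff_const.mul (contDiff_Gamdet9 A K)).contDiffOn

theorem quad_eq9 {d : ℕ} (M : Matrix (Fin d) (Fin d) ℝ) (x : Fin d → ℝ) :
    x ⬝ᵥ M.mulVec x = ∑ i, ∑ j, M i j * (x i * x j) := by
  simp only [dotProduct, mulVec, Finset.mul_sum]
  refine Finset.sum_congr rfl fun i _ => Finset.sum_congr rfl fun j _ => ?_
  ring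

theorem posDef_lower9 {d : ℕ} (M : Matrix (Fin d) (Fin d) ℝ) (hM : M.PosDef) :
    ∃ b : ℝ, 0 < b ∧ ∀ x, b * ‖x‖ ^ 2 ≤ x ⬝ᵥ M.mulVec x := by
  have hcont : Continuous fun x : Fin d → ℝ => x ⬝ᵥ M.mulVec x := by
    simp only [quad_eq9]
    fun_prop
  rcases (Metric.sphere (0 : Fin d → ℝ) 1).eq_empty_or_nonempty with h | h
  · refine ⟨1, one_pos, fun x => ?_⟩
    by_cases hx : x = 0
    · simp [hx]
    · exfalso
      have : (‖x‖⁻¹ • x) ∈ Metric.sphere (0 : Fin d → ℝ) 1 := by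
        simp [norm_smul, hx]
      rw [h] at this
      exact this
  · obtain ⟨y, hy, hmin⟩ := (isCompact_sphere (0 : Fin d → ℝ) 1).exists_isMinOn h hcont.continuousOn
    have hy0 : y ≠ 0 := by
      rintro rfl
      simp at hy
    refine ⟨_, by simpa using hM.dotProduct_mulVec_pos hy0, fun x => ?_⟩
    by_cases hx : x = 0
    · simp [hx]
    · have hs : (‖x‖⁻¹ • x) ∈ Metric.sphere (0 : Fin d → ℝ) 1 := by
        simp [norm_smul, hx]
      have := hmin hs
      simp only [Set.mem_ofPred_eq, mulVec_smul, dotProduct_smul, smul_dotProduct, smul_eq_mul] at this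
      have hn : 0 < ‖x‖ := norm_pos_iff.2 hx
      calc (y ⬝ᵥ M.mulVec y) * ‖x‖ ^ 2 ≤ (‖x‖⁻¹ * (‖x‖⁻¹ * (x ⬝ᵥ M.mulVec x))) * ‖x‖ ^ 2 := by
            gcongr
        _ = _ := by field_simp

theorem integral_iter9 {d : ℕ} (A K : Matrix (Fin d) (Fin d) ℝ) (hA : A.IsHermitian)
    (hK : K.IsHermitian) (t : ℝ) (hΓ : (Gam A K t).PosDef) (k : ℕ) (hk : 1 ≤ k) :
    ∫ x, iteratedDeriv k (fun s => gaussDensity (Gam A K s) x) t = 0 := by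
  set B : Fin d → Fin d → ℝ → ℝ := fun i j s => (Gam A K s)⁻¹ i j with hBdef
  have hqf : ∀ s x, x ⬝ᵥ (Gam A K s)⁻¹.mulVec x = qf9 B s x := fun s x => quad_eq9 _ x
  obtain ⟨b, hb, hbt⟩ := posDef_lower9 _ hΓ.inv
  have hU : IsOpen {s | 0 < (Gam A K s).det} :=
    isOpen_lt continuous_const (contDiff_Gamdet9 A K).continuous
  have htU : t ∈ {s | 0 < (Gam A K s).det} := hΓ.det_pos
  have hBc : ∀ i j, ContinuousAt (B i j) t := fun i j =>
    (contDiffOn_inv9 A K i j).continuousOn.continuousAt (hU.mem_nhds htU)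
  have hsum : ContinuousAt (fun s => ∑ i, ∑ j, |B i j s - B i j t|) t := by
    refine tendsto_finsetSum _ fun i _ => tendsto_finsetSum _ fun j _ => ?_
    exact ((hBc i j).sub continuousAt_const).abs
  have hev : ∀ᶠ s in 𝓝 t, ∑ i, ∑ j, |B i j s - B i j t| < b / 2 :=
    hsum.eventually_lt_const (by simpa using by positivity)
  obtain ⟨I, hI, hIo, htI⟩ := eventually_nhds_iff.1 (hev.and (hU.mem_nhds htU))
  have hQ : ∀ s ∈ I, ∀ x, (b / 2) * ‖x‖ ^ 2 ≤ qf9 B s x := by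
    intro s hs x
    have h1 := (hI s hs).1
    have h2 := hbt x
    rw [hqf] at h2
    have h3 : |qf9 B s x - qf9 B t x| ≤ (∑ i, ∑ j, |B i j s - B i j t|) * ‖x‖ ^ 2 := by
      unfold qf9
      simp only [← Finset.sum_sub_distrib, Finset.sum_mul, ← sub_mul]
      refine (Finset.abs_sum_le_sum_abs _ _).trans (Finset.sum_le_sum fun i _ => ?_)
      refine (Finset.abs_sum_le_sum_abs _ _).trans (Finset.sum_le_sum fun j _ => ?_)
      rw [abs_mul, abs_mul, sq]
      have h4 : |x i| ≤ ‖x‖ := norm_le_pi_norm x i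
      have h5 : |x j| ≤ ‖x‖ := norm_le_pi_norm x j
      gcongr
    have h6 : (∑ i, ∑ j, |B i j s - B i j t|) * ‖x‖ ^ 2 ≤ b / 2 * ‖x‖ ^ 2 := by gcongr
    have := (abs_le.1 h3).1
    linarith
  have hsub : I ⊆ {s | 0 < (Gam A K s).det} := fun s hs => (hI s hs).2
  have hgood : GoodF9 I B (fun s x => gaussDensity (Gam A K s) x) := by
    have := GoodF9.base (I := I) (B := B) (fun s => (√((2 * Real.pi) ^ d * (Gam A K s).det))⁻¹)
      (fun _ => 1) ((contDiffOn_c9 A K).mono hsub) continuous_const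
      (fun b hb => ⟨1, fun x => by
        rw [abs_one, one_mul]; exact Real.one_le_exp (by positivity)⟩)
    simpa only [gaussDensity, hqf, mul_one] using this
  obtain ⟨F, hF, hF'⟩ := hgood.iter hIo (fun i j => (contDiffOn_inv9 A K i j).mono hsub)
    (half_pos hb) hQ k
  have hone : ∀ s ∈ I, ∫ x, gaussDensity (Gam A K s) x = 1 := by
    intro s hs
    apply integral_gaussDensity9
    have hH : (Gam A K s).IsHermitian := by
      unfold Gam
      rw [Matrix.IsHermitian, Matrix.conjTranspose_eq_transpose_of_trivial] at *
      simp [hA, hK]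
    rw [← Matrix.posDef_inv_iff]
    refine Matrix.PosDef.of_dotProduct_mulVec_pos hH.inv fun x hx => ?_
    have h1 := hQ s hs x
    rw [← hqf] at h1
    have : 0 < b / 2 * ‖x‖ ^ 2 := by
      have := norm_pos_iff.2 hx
      positivity
    simpa using this.trans_le h1
  obtain ⟨h1, h2⟩ := hF' t htI
  simp_rw [h1]
  rw [← h2]
  have : (fun u => ∫ x, gaussDensity (Gam A K u) x) =ᶠ[𝓝 t] fun _ => (1 : ℝ) := by
    filter_upwards [hIo.mem_nhds htI] with u hu using hone u hu
  rw [this.iteratedDeriv_eq]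
  simp [iteratedDeriv_const, show k ≠ 0 by omega]

theorem meas_gaussDensity9 {d : ℕ} (K : Matrix (Fin d) (Fin d) ℝ) :
    Continuous (gaussDensity K) := by
  unfold gaussDensity
  simp only [quad_eq9]
  fun_prop

theorem cont_Gam9 {d : ℕ} (K : Matrix (Fin d) (Fin d) ℝ) (s : ℝ) :
    Continuous fun p : (Fin d → Fin d → ℝ) × (Fin d → ℝ) => Gam (Matrix.of p.1) K s := by
  refine continuous_matrix fun i j => ?_
  simp only [Gam, Matrix.add_apply, Matrix.smul_apply, smul_eq_mul, Matrix.of_apply]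
  fun_prop

theorem meas_gfun9 {d : ℕ} (K : Matrix (Fin d) (Fin d) ℝ) (s : ℝ) :
    Measurable fun p : (Fin d → Fin d → ℝ) × (Fin d → ℝ) => gfun (Matrix.of p.1) K s p.2 := by
  have hdet : Measurable fun p : (Fin d → Fin d → ℝ) × (Fin d → ℝ) =>
      (Gam (Matrix.of p.1) K s).det := (cont_Gam9 K s).matrix_det.measurable
  have hadj : ∀ i j, Measurable fun p : (Fin d → Fin d → ℝ) × (Fin d → ℝ) =>
      (Gam (Matrix.of p.1) K s).adjugate i j :=
    fun i j => ((cont_Gam9 K s).matrix_adjugate.matrix_elem i j).measurable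
  have hinv : ∀ i j, Measurable fun p : (Fin d → Fin d → ℝ) × (Fin d → ℝ) =>
      (Gam (Matrix.of p.1) K s)⁻¹ i j := by
    intro i j
    simp only [Matrix.inv_def, Ring.inverse_eq_inv', Matrix.smul_apply, smul_eq_mul]
    exact hdet.inv.mul (hadj i j)
  have hx : ∀ i, Measurable fun p : (Fin d → Fin d → ℝ) × (Fin d → ℝ) => p.2 i :=
    fun i => (measurable_pi_apply i).comp measurable_snd
  have hK : Measurable fun p : (Fin d → Fin d → ℝ) × (Fin d → ℝ) => gaussDensity K p.2 :=
    (meas_gaussDensity9 K).measurable.comp measurable_snd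
  unfold gfun
  refine Measurable.div ?_ hK
  unfold gaussDensity
  simp only [quad_eq9]
  refine ((hdet.const_mul _).sqrt.inv).mul (Measurable.exp (Measurable.const_mul ?_ _))
  refine Finset.measurable_sum _ fun i _ => Finset.measurable_sum _ fun j _ => ?_
  exact (hinv i j).mul ((hx i).mul (hx j))

theorem contDiffOn_gfun9 {d : ℕ} (A K : Matrix (Fin d) (Fin d) ℝ) (x : Fin d → ℝ) :
    ContDiffOn ℝ ∞ (fun s => gfun A K s x) {s | 0 < (Gam A K s).det} := by
  unfold gfun gaussDensity
  simp only [quad_eq9]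
  refine ContDiffOn.div_const ((contDiffOn_c9 A K).mul (ContDiffOn.exp ?_)) _
  refine contDiffOn_const.mul ?_
  refine ContDiffOn.sum fun i _ => ContDiffOn.sum fun j _ => ?_
  exact (contDiffOn_inv9 A K i j).mul contDiffOn_const

theorem isOpen_U9 {d : ℕ} (A K : Matrix (Fin d) (Fin d) ℝ) : IsOpen {s | 0 < (Gam A K s).det} :=
  isOpen_lt continuous_const (contDiff_Gamdet9 A K).continuous

theorem contDiffOn_iter9 {d : ℕ} (A K : Matrix (Fin d) (Fin d) ℝ) (x : Fin d → ℝ) (k : ℕ) :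
    ContDiffOn ℝ ∞ (iteratedDeriv k (fun s => gfun A K s x)) {s | 0 < (Gam A K s).det} := by
  induction k with
  | zero => simpa using contDiffOn_gfun9 A K x
  | succ k ih =>
    rw [iteratedDeriv_succ]
    exact ih.deriv_of_isOpen (isOpen_U9 A K) (by simp)

theorem meas_iter9 {d : ℕ} (K : Matrix (Fin d) (Fin d) ℝ) (k : ℕ) : ∀ s : ℝ,
    Measurable (Set.indicator {p : (Fin d → Fin d → ℝ) × (Fin d → ℝ) |
        0 < (Gam (Matrix.of p.1) K s).det}
      (fun p => iteratedDeriv k (fun u => gfun (Matrix.of p.1) K u p.2) s)) := by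
  have hU : ∀ s, MeasurableSet {p : (Fin d → Fin d → ℝ) × (Fin d → ℝ) |
        0 < (Gam (Matrix.of p.1) K s).det} := fun s =>
    measurableSet_lt measurable_const (cont_Gam9 K s).matrix_det.measurable
  induction k with
  | zero =>
    intro s
    simp only [iteratedDeriv_zero]
    exact (meas_gfun9 K s).indicator (hU s)
  | succ k ih =>
    intro s
    refine measurable_of_tendsto_metrizable (f := fun (n : ℕ) =>
      Set.indicator {p : (Fin d → Fin d → ℝ) × (Fin d → ℝ) | 0 < (Gam (Matrix.of p.1) K s).det}
      (fun p => ((1 : ℝ) / ((n : ℝ) + 1))⁻¹ • (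
        (Set.indicator {p : (Fin d → Fin d → ℝ) × (Fin d → ℝ) |
            0 < (Gam (Matrix.of p.1) K (s + 1 / ((n : ℝ) + 1))).det}
          (fun p => iteratedDeriv k (fun u => gfun (Matrix.of p.1) K u p.2)
            (s + 1 / ((n : ℝ) + 1)))) p -
        (Set.indicator {p : (Fin d → Fin d → ℝ) × (Fin d → ℝ) |
            0 < (Gam (Matrix.of p.1) K s).det}
          (fun p => iteratedDeriv k (fun u => gfun (Matrix.of p.1) K u p.2) s)) p))) ?_ ?_
    · intro n
      refine Measurable.indicator ?_ (hU s)
      simp only [smul_eq_mul]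
      exact ((ih _).sub (ih s)).const_mul _
    · rw [tendsto_pi_nhds]
      intro p
      by_cases hp : 0 < (Gam (Matrix.of p.1) K s).det
      · have hlim : Tendsto (fun n : ℕ => (1 : ℝ) / ((n : ℝ) + 1)) atTop (𝓝 0) :=
          tendsto_one_div_add_atTop_nhds_zero_nat
        have hlim' : Tendsto (fun n : ℕ => (1 : ℝ) / ((n : ℝ) + 1)) atTop (𝓝[≠] 0) := by
          refine tendsto_nhdsWithin_iff.2 ⟨hlim, Eventually.of_forall fun n => ?_⟩
          have : (0 : ℝ) < 1 / ((n : ℝ) + 1) := by positivity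
          exact this.ne'
        have hd : HasDerivAt (iteratedDeriv k (fun u => gfun (Matrix.of p.1) K u p.2))
            (iteratedDeriv (k + 1) (fun u => gfun (Matrix.of p.1) K u p.2) s) s := by
          rw [iteratedDeriv_succ]
          exact (((contDiffOn_iter9 (Matrix.of p.1) K p.2 k).contDiffAt
            ((isOpen_U9 (Matrix.of p.1) K).mem_nhds hp)).differentiableAt (by simp)).hasDerivAt
        have h1 := hd.tendsto_slope_zero.comp hlim'
        rw [Set.indicator_of_mem (by exact hp)]
        refine h1.congr' ?_
        have hs : Tendsto (fun n : ℕ => s + (1 : ℝ) / ((n : ℝ) + 1)) atTop (𝓝 s) := by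
          simpa using hlim.const_add s
        filter_upwards [hs.eventually ((isOpen_U9 (Matrix.of p.1) K).mem_nhds hp)] with n hn
        rw [Set.indicator_of_mem (by exact hp), Set.indicator_of_mem (by exact hn),
          Set.indicator_of_mem (by exact hp)]
        rfl
      · rw [Set.indicator_of_notMem (by exact hp)]
        refine tendsto_const_nhds.congr fun n => ?_
        rw [Set.indicator_of_notMem (by exact hp)]

theorem gaussDensity_pos9 {d : ℕ} (K : Matrix (Fin d) (Fin d) ℝ) (hK : K.PosDef) (x) :
    0 < gaussDensity K x := by
  have := hK.det_pos
  unfold gaussDensity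
  positivity

theorem gaussLaw_prob9 {d : ℕ} (K : Matrix (Fin d) (Fin d) ℝ) (hK : K.PosDef) :
    IsProbabilityMeasure (gaussLaw K) := by
  constructor
  unfold gaussLaw
  rw [withDensity_apply _ MeasurableSet.univ, Measure.restrict_univ,
    ← ofReal_integral_eq_lintegral_ofReal, integral_gaussDensity9 K hK, ENNReal.ofReal_one]
  · exact Integrable.of_integral_ne_zero (by rw [integral_gaussDensity9 K hK]; simp)
  · exact ae_of_all _ fun x => (gaussDensity_pos9 K hK x).le

theorem integral_gaussLaw9 {d : ℕ} (A K : Matrix (Fin d) (Fin d) ℝ) (hA : A.IsHermitian)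
    (hK : K.PosDef) (t : ℝ) (hΓ : (Gam A K t).PosDef) (k : ℕ) (hk : 1 ≤ k) :
    ∫ x, iteratedDeriv k (fun s => gfun A K s x) t ∂(gaussLaw K) = 0 := by
  unfold gaussLaw
  rw [integral_withDensity_eq_integral_toReal_smul
    (meas_gaussDensity9 K).measurable.ennreal_ofReal (ae_of_all _ fun x => ENNReal.ofReal_lt_top)]
  rw [← integral_iter9 A K hA hK.isHermitian t hΓ k hk]
  refine integral_congr_ae (ae_of_all _ fun x => ?_)
  have hpos := gaussDensity_pos9 K hK x
  simp only [gfun]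
  rw [ENNReal.toReal_ofReal hpos.le, iteratedDeriv_div_const, smul_eq_mul]
  field_simp

theorem eucl9 {d : ℕ} (x : Fin d → ℝ) : euclNorm x ^ 2 = x ⬝ᵥ x := by
  unfold euclNorm
  rw [Real.sq_sqrt (by positivity)]
  simp [dotProduct, sq]

theorem compact9 {d : ℕ} : IsCompact {x : Fin d → ℝ | euclNorm x = 1} := by
  have hc : Continuous (euclNorm (d := d)) := by unfold euclNorm; fun_prop
  refine (isCompact_closedBall (0 : Fin d → ℝ) 1).of_isClosed_subset
    (isClosed_eq hc continuous_const) fun x hx => ?_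
  rw [mem_closedBall_zero_iff, pi_norm_le_iff_of_nonneg zero_le_one]
  intro i
  have h1 : x i ^ 2 ≤ x ⬝ᵥ x := by
    simp only [dotProduct, ← sq]
    exact Finset.single_le_sum (f := fun i => x i ^ 2) (fun i _ => sq_nonneg _) (Finset.mem_univ i)
  have hx' : euclNorm x = 1 := hx
  rw [← eucl9, hx', one_pow] at h1
  rw [Real.norm_eq_abs]
  exact (sq_le_one_iff_abs_le_one _).1 h1

theorem lambda_pos9 {d : ℕ} (hd : 1 ≤ d) (K : Matrix (Fin d) (Fin d) ℝ) (hK : K.PosDef) :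
    0 < lambdaMin K := by
  have hcont : Continuous fun x : Fin d → ℝ => x ⬝ᵥ K.mulVec x := by
    simp only [quad_eq9]
    fun_prop
  have hne : {x : Fin d → ℝ | euclNorm x = 1}.Nonempty := by
    refine ⟨Pi.single ⟨0, hd⟩ 1, ?_⟩
    have := eucl9 (Pi.single (⟨0, hd⟩ : Fin d) (1 : ℝ))
    simp at this
    rcases this with h | h
    · exact h
    · have h0 : 0 ≤ euclNorm (Pi.single (⟨0, hd⟩ : Fin d) (1 : ℝ)) := Real.sqrt_nonneg _
      rw [h] at h0
      norm_num at h0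
  obtain ⟨y, hy, hmin⟩ := compact9.exists_isMinOn hne hcont.continuousOn
  have hy0 : y ≠ 0 := by
    rintro rfl
    have : euclNorm (0 : Fin d → ℝ) = 1 := hy
    simp [euclNorm] at this
  have h1 : 0 < y ⬝ᵥ K.mulVec y := by simpa using hK.dotProduct_mulVec_pos hy0
  refine h1.trans_le (le_csInf ?_ ?_)
  · exact ⟨_, y, hy, rfl⟩
  · rintro r ⟨x, hx, rfl⟩
    exact hmin hx

theorem lambda_le9 {d : ℕ} (K : Matrix (Fin d) (Fin d) ℝ) (hK : K.PosDef) (x : Fin d → ℝ)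
    (hx : euclNorm x = 1) : lambdaMin K ≤ x ⬝ᵥ K.mulVec x := by
  refine csInf_le ⟨0, ?_⟩ ⟨x, hx, rfl⟩
  rintro r ⟨y, hy, rfl⟩
  simpa using hK.posSemidef.dotProduct_mulVec_nonneg y

theorem le_opNorm9 {d : ℕ} (M : Matrix (Fin d) (Fin d) ℝ) (x : Fin d → ℝ)
    (hx : euclNorm x = 1) : |x ⬝ᵥ M.mulVec x| ≤ opNorm M := by
  have hcont : Continuous fun x : Fin d → ℝ => euclNorm (M.mulVec x) := by
    unfold euclNorm mulVec dotProduct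
    fun_prop
  have h1 : euclNorm (M.mulVec x) ≤ opNorm M := by
    refine le_csSup ?_ ⟨x, hx, rfl⟩
    obtain ⟨C, hC⟩ := (compact9 (d := d)).bddAbove_image hcont.continuousOn
    refine ⟨C, ?_⟩
    rintro r ⟨y, hy, rfl⟩
    exact hC ⟨y, hy, rfl⟩
  refine le_trans ?_ h1
  apply Real.abs_le_sqrt
  have h2 := Finset.sum_mul_sq_le_sq_mul_sq Finset.univ x (M.mulVec x)
  have h3 : ∑ i, x i ^ 2 = 1 := by
    have := eucl9 x
    rw [hx] at this
    simpa [dotProduct, sq] using this.symm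
  rw [h3, one_mul] at h2
  exact h2

theorem lower_Gam9 {d : ℕ} (A K : Matrix (Fin d) (Fin d) ℝ) (hK : K.PosDef) (hl : 0 < lambdaMin K)
    (t : ℝ) (ht : t ∈ Set.Icc (0 : ℝ) 1) (h : opNorm (A - K) ≤ lambdaMin K / 2)
    (x : Fin d → ℝ) (hx : euclNorm x = 1) :
    lambdaMin K / 2 ≤ x ⬝ᵥ (Gam A K t).mulVec x := by
  have h1 := (abs_le.1 (le_opNorm9 (A - K) x hx)).1
  have h2 := lambda_le9 K hK x hx
  have h3 : Gam A K t = K + t • (A - K) := by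
    unfold Gam
    rw [smul_sub, sub_smul, one_smul]
    abel
  rw [h3, add_mulVec, smul_mulVec, dotProduct_add, dotProduct_smul, smul_eq_mul]
  have h4 : -(lambdaMin K / 2) ≤ x ⬝ᵥ (A - K).mulVec x := by linarith
  nlinarith [ht.1, ht.2]

theorem posDef_of9 {d : ℕ} (M : Matrix (Fin d) (Fin d) ℝ) (hM : M.IsHermitian) {c : ℝ} (hc : 0 < c)
    (h : ∀ x, euclNorm x = 1 → c ≤ x ⬝ᵥ M.mulVec x) : M.PosDef := by
  refine Matrix.PosDef.of_dotProduct_mulVec_pos hM fun x hx => ?_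
  have hpos : 0 < euclNorm x := by
    unfold euclNorm
    apply Real.sqrt_pos.2
    obtain ⟨i, hi⟩ := Function.ne_iff.1 hx
    exact Finset.sum_pos' (fun i _ => sq_nonneg _) ⟨i, Finset.mem_univ _, sq_pos_of_ne_zero hi⟩
  have hn : euclNorm ((euclNorm x)⁻¹ • x) = 1 := by
    have h0 : 0 ≤ euclNorm ((euclNorm x)⁻¹ • x) := Real.sqrt_nonneg _
    have h1 := eucl9 ((euclNorm x)⁻¹ • x)
    rw [dotProduct_smul, smul_dotProduct, ← eucl9 x] at h1
    simp only [smul_eq_mul] at h1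
    have h2 : (euclNorm x)⁻¹ * ((euclNorm x)⁻¹ * euclNorm x ^ 2) = 1 := by field_simp
    rw [h2] at h1
    nlinarith
  have := hc.trans_le (h _ hn)
  simp only [mulVec_smul, dotProduct_smul, smul_dotProduct, smul_eq_mul] at this
  have h5 : 0 < (euclNorm x)⁻¹ := by positivity
  simpa using pos_of_mul_pos_right (pos_of_mul_pos_right this h5.le) h5.le

end helpers


/-- Remark `media_deriv_nulla`: the conditional expectation given `A` of the
`t`-derivatives of `g(A,t,G)` vanishes a.s. on the event `E`. -/
theorem statement_9
    {d : ℕ} (hd : 1 ≤ d)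
    {Ω : Type*} [mΩ : MeasurableSpace Ω] (P : Measure Ω) [IsProbabilityMeasure P]
    (K : Matrix (Fin d) (Fin d) ℝ) (hK : K.PosDef)
    (A : Ω → Matrix (Fin d) (Fin d) ℝ) (hA : ∀ ω, (A ω).PosSemidef)
    (hAmeas : Measurable fun ω i j => A ω i j)
    (G : Ω → Fin d → ℝ) (hG : Measure.map G P = gaussLaw K)
    (hInd : IndepFun G (fun ω i j => A ω i j) P)
    (k : ℕ) (hk : 1 ≤ k) (t : ℝ) (ht : t ∈ Set.Icc (0 : ℝ) 1) :
    ∀ᵐ ω ∂P, ω ∈ EvSet A K →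
      (P[(fun ω' => iteratedDeriv k (fun s => gfun (A ω') K s (G ω')) t) |
          MeasurableSpace.comap (fun ω' i j => A ω' i j)
            (inferInstance : MeasurableSpace (Fin d → Fin d → ℝ))]) ω = 0 := by
  classical
  have hl := lambda_pos9 hd K hK
  have := gaussLaw_prob9 K hK
  set A' : Ω → Fin d → Fin d → ℝ := fun ω i j => A ω i j with hA'
  set f : Ω → ℝ := fun ω' => iteratedDeriv k (fun s => gfun (A ω') K s (G ω')) t with hf
  have hle : (MeasurableSpace.comap A' inferInstance) ≤ mΩ := hAmeas.comap_le
  by_cases hint : Integrable f P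
  swap
  · refine Filter.Eventually.of_forall fun ω _ => ?_
    rw [condExp_of_not_integrable hint]
    rfl
  have hGm : AEMeasurable G P := by
    apply aemeasurable_of_map_neZero
    rw [hG]
    exact inferInstance
  -- the closed set of good matrices
  let E' : Set (Fin d → Fin d → ℝ) := {a | (∀ i j, a i j = a j i) ∧
    ∀ x : Fin d → ℝ, euclNorm x = 1 → lambdaMin K / 2 ≤ x ⬝ᵥ (Gam (Matrix.of a) K t).mulVec x}
  have hE'c : IsClosed E' := by
    have h1 : IsClosed {a : Fin d → Fin d → ℝ | ∀ i j, a i j = a j i} := by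
      simp only [Set.ofPred_forall]
      exact isClosed_iInter fun i => isClosed_iInter fun j =>
        isClosed_eq (by fun_prop) (by fun_prop)
    have h2 : IsClosed {a : Fin d → Fin d → ℝ | ∀ x : Fin d → ℝ, euclNorm x = 1 →
        lambdaMin K / 2 ≤ x ⬝ᵥ (Gam (Matrix.of a) K t).mulVec x} := by
      simp only [Set.ofPred_forall]
      refine isClosed_iInter fun x => isClosed_iInter fun _ => isClosed_le continuous_const ?_
      simp only [quad_eq9, Gam, Matrix.add_apply, Matrix.smul_apply, smul_eq_mul, Matrix.of_apply]
      fun_prop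
    exact h1.inter h2
  have hE'm : MeasurableSet E' := hE'c.measurableSet
  have hPD : ∀ a ∈ E', (Matrix.of a).IsHermitian ∧ (Gam (Matrix.of a) K t).PosDef := by
    intro a ha
    have h1 : (Matrix.of a).IsHermitian := by
      ext i j
      simp [ha.1 j i]
    refine ⟨h1, posDef_of9 _ ?_ (half_pos hl) ha.2⟩
    have h2 := hK.isHermitian
    unfold Gam
    rw [Matrix.IsHermitian, Matrix.conjTranspose_eq_transpose_of_trivial] at *
    rw [Matrix.transpose_add, Matrix.transpose_smul, Matrix.transpose_smul, h1, h2]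
  have hEE' : ∀ ω ∈ EvSet A K, A' ω ∈ E' := by
    intro ω hω
    refine ⟨fun i j => ?_, fun x hx => lower_Gam9 (A ω) K hK hl t ht hω x hx⟩
    simpa using (hA ω).isHermitian.apply j i
  set T : Set Ω := A' ⁻¹' E' with hT
  have hTm : MeasurableSet[(MeasurableSpace.comap A' inferInstance)] T := ⟨E', hE'm, rfl⟩
  have hcond := condExp_indicator (m := (MeasurableSpace.comap A' inferInstance)) hint hTm
  have hmap : Measure.map (fun ω => (A' ω, G ω)) P = (Measure.map A' P).prod (gaussLaw K) := by
    rw [← hG]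
    exact (indepFun_iff_map_prod_eq_prod_map_map hAmeas.aemeasurable hGm).1 hInd.symm
  have hpair : AEMeasurable (fun ω => (A' ω, G ω)) P := hAmeas.aemeasurable.prodMk hGm
  have hzero : (0 : Ω → ℝ) =ᵐ[P] P[T.indicator f | (MeasurableSpace.comap A' inferInstance)] := by
    refine ae_eq_condExp_of_forall_setIntegral_eq hle (hint.indicator (hle _ hTm))
      (fun s _ _ => integrableOn_zero) ?_ aestronglyMeasurable_zero
    rintro S ⟨S', hS', rfl⟩ -
    simp only [Pi.zero_apply, integral_zero]
    have hSm : MeasurableSet (A' ⁻¹' S') := hAmeas hS'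
    rw [setIntegral_indicator (hle _ hTm), ← integral_indicator (hSm.inter (hle _ hTm))]
    let h : (Fin d → Fin d → ℝ) × (Fin d → ℝ) → ℝ := Set.indicator ((S' ∩ E') ×ˢ Set.univ)
      (Set.indicator {p : (Fin d → Fin d → ℝ) × (Fin d → ℝ) |
        0 < (Gam (Matrix.of p.1) K t).det}
      (fun p => iteratedDeriv k (fun u => gfun (Matrix.of p.1) K u p.2) t))
    have hh : Measurable h :=
      (meas_iter9 K k t).indicator ((hS'.inter hE'm).prod MeasurableSet.univ)
    have heq : (A' ⁻¹' S' ∩ T).indicator f = fun ω => h (A' ω, G ω) := by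
      funext ω
      by_cases hω : A' ω ∈ S' ∩ E'
      · have h1 : ω ∈ A' ⁻¹' S' ∩ T := hω
        have h2 : (A' ω, G ω) ∈ (S' ∩ E') ×ˢ (Set.univ : Set (Fin d → ℝ)) := ⟨hω, trivial⟩
        simp only [h]
        rw [Set.indicator_of_mem h1, Set.indicator_of_mem h2,
          Set.indicator_of_mem (by exact (hPD _ hω.2).2.det_pos)]
        rfl
      · have h1 : ω ∉ A' ⁻¹' S' ∩ T := hω
        have h2 : (A' ω, G ω) ∉ (S' ∩ E') ×ˢ (Set.univ : Set (Fin d → ℝ)) := fun hc => hω hc.1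
        simp only [h]
        rw [Set.indicator_of_notMem h1, Set.indicator_of_notMem h2]
    have hhi : Integrable h ((Measure.map A' P).prod (gaussLaw K)) := by
      rw [← hmap, integrable_map_measure hh.aestronglyMeasurable hpair]
      have := hint.indicator (hSm.inter (hle _ hTm))
      rw [heq] at this
      exact this
    rw [heq, ← integral_map hpair hh.aestronglyMeasurable, hmap]
    haveI : IsProbabilityMeasure (Measure.map A' P) :=
      Measure.isProbabilityMeasure_map hAmeas.aemeasurable
    rw [integral_prod _ hhi]
    symm
    refine integral_eq_zero_of_ae (Filter.Eventually.of_forall fun a => ?_)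
    by_cases ha : a ∈ S' ∩ E'
    · obtain ⟨h1, h2⟩ := hPD a ha.2
      have := integral_gaussLaw9 (Matrix.of a) K h1 hK t h2 k hk
      simp only [Pi.zero_apply]
      rw [← this]
      congr 1
      funext x
      have h2' : (a, x) ∈ (S' ∩ E') ×ˢ (Set.univ : Set (Fin d → ℝ)) := ⟨ha, trivial⟩
      simp only [h]
      rw [Set.indicator_of_mem h2', Set.indicator_of_mem (by exact h2.det_pos)]
    · simp only [Pi.zero_apply]
      have : ∀ x, h (a, x) = 0 := fun x => Set.indicator_of_notMem (fun hc => ha hc.1) _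
      simp [this]
  filter_upwards [hcond, hzero] with ω h1 h2 hω
  have hωT : ω ∈ T := hEE' ω hω
  rw [Set.indicator_of_mem hωT] at h1
  rw [← h1, ← h2]
  rfl
end

section
/- Let N ~ N_d(0,I_d) be independent of A and set F_t := √Γ_t · N for t ∈ [0,1]. Then for every integer k ≥ 1 and every t ∈ [0,1], E[ (h_k(A,t,F_t))² · 1_E ] = (k!/2^k) · E[ ( ⟨ N , √Γ_t^{−1}(A−K)Γ_t^{−1}(A−K)√Γ_t^{−1} N ⟩ )^k · 1_E ]. -/
open MeasureTheory ProbabilityTheory Matrix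

/-- Standard Gaussian on `ℝ`. -/
noncomputable abbrev gam1 : Measure ℝ := gaussianReal 0 1

lemma integrable_poly (p : Polynomial ℝ) : Integrable (fun x => p.eval x) gam1 := by
  have hpow : ∀ n : ℕ, Integrable (fun x : ℝ => x ^ n) gam1 := by
    intro n
    rcases Nat.eq_zero_or_pos n with rfl | hn
    · simp
    · have h := memLp_id_gaussianReal (μ := 0) (v := 1) (n : NNReal)
      have := h.integrable_norm_pow (by omega)
      refine this.mono' (by fun_prop) ?_
      filter_upwards with x
      simp
  simp only [Polynomial.eval_eq_sum_range]
  exact integrable_finsetSum _ fun i _ => (hpow i).const_mul _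

lemma gam1_integral (f : ℝ → ℝ) : ∫ x, f x ∂gam1 = ∫ x, gaussianPDFReal 0 1 x * f x := by
  rw [integral_gaussianReal_eq_integral_smul (by norm_num)]
  rfl

lemma gam1_integrable_iff (f : ℝ → ℝ) :
    Integrable f gam1 ↔ Integrable (fun x => f x * gaussianPDFReal 0 1 x) := by
  unfold gam1
  rw [gaussianReal_of_var_ne_zero _ (by norm_num),
    integrable_withDensity_iff (measurable_gaussianPDF _ _)
    (by filter_upwards with x; exact ENNReal.ofReal_lt_top)]
  simp [toReal_gaussianPDF]

lemma hasDerivAt_pdf (x : ℝ) :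
    HasDerivAt (gaussianPDFReal 0 1) (-x * gaussianPDFReal 0 1 x) x := by
  unfold gaussianPDFReal
  have h : HasDerivAt (fun x : ℝ => -(x-0)^2 / (2 * ((1:NNReal):ℝ))) (-x) x := by
    have := (((hasDerivAt_id x).sub_const 0).pow 2).neg.div_const (2 * ((1:NNReal):ℝ))
    convert! this using 1
    simp; ring
  convert! (h.exp.const_mul ((√(2 * Real.pi * ((1:NNReal):ℝ)))⁻¹)) using 1
  ring

lemma stein (p : Polynomial ℝ) :
    ∫ x, (Polynomial.X * p).eval x ∂gam1 = ∫ x, (Polynomial.derivative p).eval x ∂gam1 := by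
  rw [gam1_integral, gam1_integral]
  have h := integral_mul_deriv_eq_deriv_mul_of_integrable (u := fun x => p.eval x)
    (v := gaussianPDFReal 0 1)
    (u' := fun x => (Polynomial.derivative p).eval x) (v' := fun x => -x * gaussianPDFReal 0 1 x)
    (fun x _ => p.hasDerivAt x) (fun x _ => hasDerivAt_pdf x) ?_ ?_ ?_
  · calc _ = - ∫ x, Polynomial.eval x p * (-x * gaussianPDFReal 0 1 x) := by
          rw [← integral_neg]
          congr 1; ext x; simp; ring
      _ = _ := by
          rw [h, neg_neg]; congr 1; ext x; ring
  · have := (gam1_integrable_iff _).1 (integrable_poly (-Polynomial.X * p))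
    convert! this using 1; ext x; simp; ring
  · exact (gam1_integrable_iff _).1 (integrable_poly _)
  · exact (gam1_integrable_iff _).1 (integrable_poly _)

lemma moment_even (m : ℕ) : ∫ x, x ^ (2 * m) ∂gam1 = ((2 * m).factorial : ℝ) / (2 ^ m * m.factorial) := by
  induction m with
  | zero => simp
  | succ m ih =>
    have h := stein (Polynomial.X ^ (2 * m + 1))
    simp only [← pow_succ', Polynomial.eval_pow, Polynomial.eval_X, Polynomial.derivative_X_pow,
      Polynomial.eval_mul, Polynomial.eval_C, Nat.add_sub_cancel] at h
    rw [show 2 * (m + 1) = 2 * m + 1 + 1 by ring, h, integral_const_mul, ih, Nat.factorial_succ (2 * m + 1),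
      Nat.factorial_succ (2 * m), Nat.factorial_succ m]
    push_cast
    field_simp
    ring

/-- Real Hermite polynomials. -/
noncomputable def Her (n : ℕ) : Polynomial ℝ := (Polynomial.hermite n).map (Int.castRingHom ℝ)

lemma Her_zero : Her 0 = 1 := by simp [Her]

lemma Her_succ (n : ℕ) : Her (n + 1) = Polynomial.X * Her n - Polynomial.derivative (Her n) := by
  simp [Her, Polynomial.hermite_succ, Polynomial.derivative_map]

lemma Her_deriv (n : ℕ) : Polynomial.derivative (Her (n + 1)) = (n + 1 : Polynomial ℝ) * Her n := by
  induction n with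
  | zero => simp [Her_succ, Her_zero]
  | succ n ih =>
    rw [Her_succ (n + 1), Polynomial.derivative_sub, Polynomial.derivative_mul, ih,
      Polynomial.derivative_mul, Her_succ n]
    simp; ring

lemma Her_orth (m n : ℕ) :
    ∫ x, (Her m).eval x * (Her n).eval x ∂gam1 = if m = n then (n.factorial : ℝ) else 0 := by
  have h0 : ∀ m, ∫ x, (Her (m + 1)).eval x ∂gam1 = 0 := by
    intro m
    simp only [Her_succ, Polynomial.eval_sub]
    rw [integral_sub (integrable_poly _) (integrable_poly _), stein, sub_self]
  induction m generalizing n with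
  | zero =>
    cases n with
    | zero => simp [Her_zero]
    | succ n => simpa [Her_zero] using h0 n
  | succ m ih =>
    cases n with
    | zero => simpa [Her_zero] using h0 m
    | succ n =>
      have e1 : ∀ x, (Her (m + 1)).eval x * (Her (n + 1)).eval x =
          (Polynomial.X * (Her m * Her (n + 1))).eval x
            - (Polynomial.derivative (Her m) * Her (n + 1)).eval x := by
        intro x; rw [Her_succ m]; simp; ring
      have e2 : ∀ x, (Polynomial.derivative (Her m * Her (n + 1))).eval x =
         (Polynomial.derivative (Her m) * Her (n + 1)).eval x
          + ((n:ℝ) + 1) * ((Her m).eval x * (Her n).eval x) := by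
        intro x; rw [Polynomial.derivative_mul, Her_deriv]; simp; ring
      simp only [e1]
      rw [integral_sub (integrable_poly _) (integrable_poly _), stein]
      simp only [e2]
      rw [integral_add (integrable_poly _), integral_const_mul, ih]
      · simp [Nat.factorial_succ]
      · simpa using (integrable_poly (Her m * Her n)).const_mul ((n:ℝ)+1)

/-- One-dimensional density ratio. -/
noncomputable def G1 (x s : ℝ) : ℝ := (√(1 + s))⁻¹ * Real.exp (1/2 * (x ^ 2 * (s / (1 + s))))

lemma G1_contDiffAt (x b s : ℝ) (h : 0 < 1 + s * b) (n : WithTop ℕ∞) :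
    ContDiffAt ℝ n (fun s => G1 x (s * b)) s := by
  unfold G1
  have h1 : ContDiffAt ℝ n (fun s => 1 + s * b) s := by fun_prop
  refine ContDiffAt.mul ?_ ?_
  · exact (h1.sqrt h.ne').inv (by positivity)
  · refine ContDiffAt.exp ?_
    refine contDiffAt_const.mul (contDiffAt_const.mul (ContDiffAt.div (by fun_prop) h1 h.ne'))

lemma G1_iteratedDeriv (x b : ℝ) (k : ℕ) : ∀ s, 0 < 1 + s * b →
    iteratedDeriv k (fun s => G1 x (s * b)) s =
      (b / 2) ^ k * ((1 + s * b)⁻¹) ^ k * (Her (2 * k)).eval (x * (√(1 + s * b))⁻¹) * G1 x (s * b) := by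
  induction k with
  | zero => intro s hs; simp [Her_zero]
  | succ k ih =>
    intro s hs
    rw [iteratedDeriv_succ]
    have hev : ∀ᶠ s' in nhds s, 0 < 1 + s' * b := by
      have : Continuous (fun s : ℝ => 1 + s * b) := by fun_prop
      exact this.continuousAt.eventually (lt_mem_nhds hs)
    have heq := hev.mono ih
    rw [Filter.EventuallyEq.deriv_eq heq]
    have hv : HasDerivAt (fun s : ℝ => 1 + s * b) b s := by
      simpa using ((hasDerivAt_id s).mul_const b).const_add 1
    set w := √(1 + s * b) with hw
    have hwpos : 0 < w := Real.sqrt_pos.2 hs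
    have hw2 : 1 + s * b = w ^ 2 := (Real.sq_sqrt hs.le).symm
    have hsq : HasDerivAt (fun s : ℝ => (√(1 + s * b))⁻¹) (-(b / (2 * w)) / w ^ 2) s :=
      (hv.sqrt hs.ne').inv hwpos.ne'
    have hinv : HasDerivAt (fun s : ℝ => ((1 + s * b)⁻¹) ^ k)
        (k * ((1 + s * b)⁻¹) ^ (k-1) * (-b / (1 + s * b) ^ 2)) s :=
      (hv.inv hs.ne').pow k
    have hH : HasDerivAt (fun s : ℝ => (Her (2 * k)).eval (x * (√(1 + s * b))⁻¹))
        ((Polynomial.derivative (Her (2 * k))).eval (x * w⁻¹) * (x * (-(b / (2 * w)) / w ^ 2))) s :=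
      HasDerivAt.comp s ((Her (2 * k)).hasDerivAt _) (hsq.const_mul x)
    have hfrac : HasDerivAt (fun s : ℝ => s * b / (1 + s * b)) (b / w ^ 4) s := by
      have hb : HasDerivAt (fun s : ℝ => s * b) b s := by simpa using (hasDerivAt_id s).mul_const b
      convert! hb.div hv hs.ne' using 1
      rw [show s * b = w ^ 2 - 1 by linarith]
      field_simp; ring
    have hG : HasDerivAt (fun s : ℝ => G1 x (s * b))
        (G1 x (s * b) * (b / (2 * w ^ 2)) * ((x * w⁻¹) ^ 2 - 1)) s := by
      unfold G1
      convert! hsq.mul ((hfrac.const_mul (x ^ 2)).const_mul (1/2)).exp using 1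
      rw [← hw]
      field_simp; ring
    have htot := (((hinv.const_mul ((b/2)^k)).mul hH).mul hG).deriv
    have hHH : (Her (2 * (k + 1))).eval (x * w⁻¹) = (x * w⁻¹) ^ 2 * (Her (2 * k)).eval (x * w⁻¹)
        - (x * w⁻¹) * (Polynomial.derivative (Her (2 * k))).eval (x * w⁻¹)
        - (2 * k + 1) * (Her (2 * k)).eval (x * w⁻¹) := by
      rw [show 2 * (k + 1) = 2 * k + 1 + 1 by ring, Her_succ (2 * k + 1), Her_deriv, Her_succ (2 * k)]
      simp; ring
    rw [hHH]
    refine htot.trans ?_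
    simp only [Pi.mul_apply]
    rw [← hw, hw2]
    rcases k with _ | k
    · simp; field_simp; ring
    · simp only [Nat.add_sub_cancel]
      generalize (Polynomial.derivative (Her (2 * (k + 1)))).eval (x * w⁻¹) = Q
      generalize (Her (2 * (k + 1))).eval (x * w⁻¹) = R
      generalize G1 x (s * b) = g
      rw [pow_succ ((w ^ 2)⁻¹) (k + 1), pow_succ ((w ^ 2)⁻¹) k, pow_succ (b / 2) (k + 1)]
      generalize ((w ^ 2)⁻¹) ^ k = c
      generalize (b / 2) ^ (k + 1) = c'
      push_cast
      field_simp; ring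


lemma iterDeriv_prod {ι : Type*} [Fintype ι] [DecidableEq ι] (f : ι → ℝ → ℝ)
    (hf : ∀ i (n : ℕ), ContDiffAt ℝ n (f i) 0) (k : ℕ) :
    iteratedDeriv k (fun s => ∏ i, f i s) 0 = (k.factorial : ℝ) *
      ∑ α ∈ Finset.piAntidiag (Finset.univ : Finset ι) k,
        ∏ i, (iteratedDeriv (α i) (f i) 0 / ((α i).factorial : ℝ)) := by
  let τ : (ℝ → ℝ) → PowerSeries ℝ := fun f => PowerSeries.mk fun k => iteratedDeriv k f 0 / (k.factorial : ℝ)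
  have hmul : ∀ f g : ℝ → ℝ, (∀ n : ℕ, ContDiffAt ℝ n f 0) → (∀ n : ℕ, ContDiffAt ℝ n g 0) →
      τ (fun s => f s * g s) = τ f * τ g := by
    intro f g hf hg
    ext n
    simp only [τ, PowerSeries.coeff_mul, PowerSeries.coeff_mk]
    rw [iteratedDeriv_fun_mul (hf n) (hg n), Finset.Nat.sum_antidiagonal_eq_sum_range_succ
      (f := fun i j => iteratedDeriv i f 0 / (i.factorial : ℝ) * (iteratedDeriv j g 0 / (j.factorial : ℝ))),
      Finset.sum_div]
    refine Finset.sum_congr rfl fun i hi => ?_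
    have hi' : i ≤ n := by simpa [Nat.lt_succ_iff] using hi
    rw [Nat.cast_choose ℝ hi']
    have h1 : (n.factorial : ℝ) ≠ 0 := by positivity
    field_simp
  have hone : τ (fun _ => 1) = 1 := by
    ext n
    simp only [τ, PowerSeries.coeff_mk, PowerSeries.coeff_one]
    rcases n with _ | n
    · simp
    · simp [iteratedDeriv_const]
  have hprod : ∀ S : Finset ι, τ (fun s => ∏ i ∈ S, f i s) = ∏ i ∈ S, τ (f i) := by
    intro S
    induction S using Finset.induction_on with
    | empty => simpa using hone
    | insert a S ha ih =>
      simp only [Finset.prod_insert ha]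
      rw [hmul _ _ (hf a), ih]
      intro n
      exact contDiffAt_prod fun i _ => hf i n
  have h := congrArg (PowerSeries.coeff k) (hprod Finset.univ)
  rw [PowerSeries.coeff_prod] at h
  simp only [τ, PowerSeries.coeff_mk] at h
  rw [div_eq_iff (by positivity)] at h
  rw [h, mul_comm]
  congr 1
  refine Finset.sum_bij (fun l _ => ⇑l) ?_ ?_ ?_ ?_
  · intro l hl
    simpa [Finset.mem_finsuppAntidiag] using hl
  · intro a _ b _ hab
    exact DFunLike.coe_injective hab
  · intro α hα
    refine ⟨Finsupp.equivFunOnFinite.symm α, ?_, ?_⟩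
    · simpa [Finset.mem_finsuppAntidiag] using hα
    · ext i; simp
  · intro l _
    rfl

noncomputable def hpoly {d : ℕ} (b : Fin d → ℝ) (k : ℕ) (y : Fin d → ℝ) : ℝ :=
  (k.factorial : ℝ) * ∑ α ∈ Finset.piAntidiag (Finset.univ : Finset (Fin d)) k,
    ∏ i, (((b i / 2) ^ (α i) / ((α i).factorial : ℝ)) * (Her (2 * α i)).eval (y i))

noncomputable abbrev gamd (d : ℕ) : Measure (Fin d → ℝ) := Measure.pi fun _ => gam1

lemma iterDeriv_G {d : ℕ} (b : Fin d → ℝ) (k : ℕ) (y : Fin d → ℝ) :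
    iteratedDeriv k (fun s => ∏ i, G1 (y i) (s * b i)) 0 = hpoly b k y := by
  rw [iterDeriv_prod (fun i s => G1 (y i) (s * b i)) (fun i n => G1_contDiffAt _ _ _ (by simp) _)]
  unfold hpoly
  congr 1
  refine Finset.sum_congr rfl fun α _ => Finset.prod_congr rfl fun i _ => ?_
  rw [G1_iteratedDeriv _ _ _ _ (by simp)]
  simp [G1]
  ring

lemma core_lhs {d : ℕ} (b : Fin d → ℝ) (k : ℕ) :
    Integrable (fun y => hpoly b k y ^ 2) (gamd d) ∧
    ∫ y, hpoly b k y ^ 2 ∂(gamd d) = (k.factorial : ℝ) ^ 2 *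
      ∑ α ∈ Finset.piAntidiag (Finset.univ : Finset (Fin d)) k,
        ∏ i, (((b i / 2) ^ (α i) / ((α i).factorial : ℝ)) ^ 2 * ((2 * α i).factorial : ℝ)) := by
  have hexp : ∀ y, hpoly b k y ^ 2 = (k.factorial : ℝ) ^ 2 *
      ∑ α ∈ Finset.piAntidiag (Finset.univ : Finset (Fin d)) k,
      ∑ β ∈ Finset.piAntidiag (Finset.univ : Finset (Fin d)) k,
      ∏ i, ((((b i / 2) ^ (α i) / ((α i).factorial : ℝ)) * ((b i / 2) ^ (β i) / ((β i).factorial : ℝ))) *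
       ((Her (2 * α i)).eval (y i) * (Her (2 * β i)).eval (y i))) := by
    intro y
    rw [hpoly, mul_pow, sq (∑ α ∈ _, _), Finset.sum_mul_sum]
    congr 1
    refine Finset.sum_congr rfl fun α _ => Finset.sum_congr rfl fun β _ => ?_
    rw [← Finset.prod_mul_distrib]
    refine Finset.prod_congr rfl fun i _ => ?_
    ring
  have hintg : ∀ α β : Fin d → ℕ, Integrable (fun y : Fin d → ℝ =>
      ∏ i, ((((b i / 2) ^ (α i) / ((α i).factorial : ℝ)) * ((b i / 2) ^ (β i) / ((β i).factorial : ℝ))) *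
       ((Her (2 * α i)).eval (y i) * (Her (2 * β i)).eval (y i)))) (gamd d) := by
    intro α β
    refine Integrable.fintype_prod (f := fun i x => ((((b i / 2) ^ (α i) / ((α i).factorial : ℝ)) * ((b i / 2) ^ (β i) / ((β i).factorial : ℝ))) *
       ((Her (2 * α i)).eval x * (Her (2 * β i)).eval x))) fun i => ?_
    refine Integrable.const_mul ?_ _
    simpa using integrable_poly (Her (2 * α i) * Her (2 * β i))
  simp only [hexp]
  refine ⟨?_, ?_⟩
  · refine Integrable.const_mul ?_ _
    exact integrable_finsetSum _ fun α _ => integrable_finsetSum _ fun β _ => hintg α β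
  rw [integral_const_mul, integral_finsetSum _ fun α _ => integrable_finsetSum _ fun β _ => hintg α β]
  congr 1
  refine Finset.sum_congr rfl fun α hα => ?_
  rw [integral_finsetSum _ fun β _ => hintg α β]
  have hval : ∀ β : Fin d → ℕ, ∫ y, ∏ i, ((((b i / 2) ^ (α i) / ((α i).factorial : ℝ)) * ((b i / 2) ^ (β i) / ((β i).factorial : ℝ))) *
       ((Her (2 * α i)).eval (y i) * (Her (2 * β i)).eval (y i))) ∂(gamd d) =
      ∏ i, ((((b i / 2) ^ (α i) / ((α i).factorial : ℝ)) * ((b i / 2) ^ (β i) / ((β i).factorial : ℝ))) *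
       (if 2 * α i = 2 * β i then ((2 * β i).factorial : ℝ) else 0)) := by
    intro β
    have := integral_fintype_prod_eq_prod (𝕜 := ℝ) (μ := fun _ : Fin d => gam1) (f := fun i x => ((((b i / 2) ^ (α i) / ((α i).factorial : ℝ)) * ((b i / 2) ^ (β i) / ((β i).factorial : ℝ))) *
       ((Her (2 * α i)).eval x * (Her (2 * β i)).eval x)))
    refine this.trans ?_
    refine Finset.prod_congr rfl fun i _ => ?_
    rw [integral_const_mul, Her_orth]
  simp only [hval]
  rw [Finset.sum_eq_single_of_mem α hα]
  · refine Finset.prod_congr rfl fun i _ => ?_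
    rw [if_pos rfl]; ring
  · intro β _ hne
    obtain ⟨i, hi⟩ := Function.ne_iff.1 hne
    refine Finset.prod_eq_zero (Finset.mem_univ i) ?_
    rw [if_neg (by omega), mul_zero]

lemma core_rhs {d : ℕ} (b : Fin d → ℝ) (k : ℕ) :
    Integrable (fun y => (∑ i, b i ^ 2 * y i ^ 2) ^ k) (gamd d) ∧
    ∫ y, (∑ i, b i ^ 2 * y i ^ 2) ^ k ∂(gamd d) =
      ∑ α ∈ Finset.piAntidiag (Finset.univ : Finset (Fin d)) k, (Nat.multinomial Finset.univ α : ℝ) *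
        ∏ i, ((b i ^ 2) ^ (α i) * (((2 * α i).factorial : ℝ) / (2 ^ (α i) * (α i).factorial))) := by
  have hexp : ∀ y : Fin d → ℝ, (∑ i, b i ^ 2 * y i ^ 2) ^ k =
      ∑ α ∈ Finset.piAntidiag (Finset.univ : Finset (Fin d)) k, (Nat.multinomial Finset.univ α : ℝ) *
        ∏ i, ((b i ^ 2) ^ (α i) * (y i) ^ (2 * α i)) := by
    intro y
    rw [Finset.sum_pow_eq_sum_piAntidiag]
    simp only [mul_pow, pow_mul]
  have hintg : ∀ α : Fin d → ℕ, Integrable (fun y : Fin d → ℝ => (Nat.multinomial Finset.univ α : ℝ) *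
      ∏ i, ((b i ^ 2) ^ (α i) * (y i) ^ (2 * α i))) (gamd d) := by
    intro α
    refine Integrable.const_mul ?_ _
    refine Integrable.fintype_prod (f := fun i x => ((b i ^ 2) ^ (α i) * x ^ (2 * α i))) fun i => ?_
    refine Integrable.const_mul ?_ _
    simpa using integrable_poly (Polynomial.X ^ (2 * α i))
  simp only [hexp]
  refine ⟨integrable_finsetSum _ fun α _ => hintg α, ?_⟩
  rw [integral_finsetSum _ fun α _ => hintg α]
  refine Finset.sum_congr rfl fun α _ => ?_
  rw [integral_const_mul]
  congr 1
  have := integral_fintype_prod_eq_prod (𝕜 := ℝ) (μ := fun _ : Fin d => gam1) (f := fun i x => ((b i ^ 2) ^ (α i) * x ^ (2 * α i)))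
  refine this.trans ?_
  refine Finset.prod_congr rfl fun i _ => ?_
  rw [integral_const_mul, moment_even]

lemma core_eq {d : ℕ} (b : Fin d → ℝ) (k : ℕ) :
    ∫ y, hpoly b k y ^ 2 ∂(gamd d) =
      (k.factorial : ℝ) / 2 ^ k * ∫ y, (∑ i, b i ^ 2 * y i ^ 2) ^ k ∂(gamd d) := by
  rw [(core_lhs b k).2, (core_rhs b k).2, Finset.mul_sum, Finset.mul_sum]
  refine Finset.sum_congr rfl fun α hα => ?_
  have hsum : ∑ i, α i = k := by simpa using hα
  have hm := Nat.multinomial_spec (Finset.univ : Finset (Fin d)) α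
  rw [hsum] at hm
  have hm' : (∏ i, ((α i).factorial : ℝ)) * (Nat.multinomial Finset.univ α : ℝ) = k.factorial := by
    exact_mod_cast hm
  have hp : (∏ i, ((α i).factorial : ℝ)) ≠ 0 := Finset.prod_ne_zero_iff.2 fun i _ => by positivity
  have h2 : (2:ℝ) ^ k = ∏ i, (2:ℝ) ^ (α i) := by rw [Finset.prod_pow_eq_pow_sum, hsum]
  have hmul : (Nat.multinomial Finset.univ α : ℝ) = k.factorial * ∏ i, ((α i).factorial : ℝ)⁻¹ := by
    rw [Finset.prod_inv_distrib, ← hm']; field_simp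
  rw [hmul, h2, div_eq_mul_inv, ← Finset.prod_inv_distrib]
  have : ∀ a b c d : ℝ, a * b * (a * c * d) = a ^ 2 * (b * c * d) := by intros; ring
  rw [this, ← Finset.prod_mul_distrib, ← Finset.prod_mul_distrib]
  congr 1
  refine Finset.prod_congr rfl fun i _ => ?_
  rw [div_pow, div_pow, div_pow, ← pow_mul, ← pow_mul, mul_comm 2 (α i), ← pow_mul]
  have : (2:ℝ) ^ (α i * 2) = 2 ^ (α i) * 2 ^ (α i) := by rw [pow_mul, sq]
  rw [this]
  field_simp
  rw [mul_comm]


lemma gaussDensity_one {d : ℕ} (x : Fin d → ℝ) :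
    gaussDensity 1 x = ∏ i, gaussianPDFReal 0 1 (x i) := by
  simp only [gaussDensity, gaussianPDFReal]
  rw [Finset.prod_mul_distrib, ← Real.exp_sum]
  congr 1
  · rw [Finset.prod_const, inv_pow, Real.sqrt_eq_rpow, Real.sqrt_eq_rpow, ← Real.rpow_mul_natCast (by positivity)]
    simp only [det_one, mul_one, NNReal.coe_one, Finset.card_univ, Fintype.card_fin]
    rw [← Real.rpow_natCast, ← Real.rpow_mul (by positivity)]
    ring_nf
  · congr 1
    rw [inv_one, one_mulVec, dotProduct, Finset.mul_sum]
    refine Finset.sum_congr rfl fun i _ => ?_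
    simp; ring

lemma gaussLaw_one (d : ℕ) : gaussLaw (1 : Matrix (Fin d) (Fin d) ℝ) = gamd d := by
  symm
  refine Measure.pi_eq fun s hs => ?_
  rw [gaussLaw, withDensity_apply _ (MeasurableSet.univ_pi hs), volume_pi, Measure.restrict_pi_pi]
  simp only [gaussDensity_one]
  have hi : ∀ i, Integrable (gaussianPDFReal 0 1) (volume.restrict (s i)) :=
    fun i => (integrable_gaussianPDFReal 0 1).restrict
  have hintg : Integrable (fun x : Fin d → ℝ => ∏ i, gaussianPDFReal 0 1 (x i))
      (Measure.pi fun i => (volume : Measure ℝ).restrict (s i)) :=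
    Integrable.fintype_prod (f := fun _ => gaussianPDFReal 0 1) hi
  rw [← ofReal_integral_eq_lintegral_ofReal hintg
    (Filter.Eventually.of_forall fun x => Finset.prod_nonneg fun i _ => gaussianPDFReal_nonneg _ _ _)]
  rw [integral_fintype_prod_eq_prod (𝕜 := ℝ) (f := fun _ => gaussianPDFReal 0 1)]
  rw [ENNReal.ofReal_prod_of_nonneg fun i _ => integral_nonneg fun x => gaussianPDFReal_nonneg _ _ _]
  refine Finset.prod_congr rfl fun i _ => ?_
  rw [gam1, gaussianReal_apply_eq_integral _ (by norm_num)]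

lemma measurable_mulVec_const {d : ℕ} (U : Matrix (Fin d) (Fin d) ℝ) :
    Measurable (fun n : Fin d → ℝ => U *ᵥ n) := by
  have : Continuous (fun n : Fin d → ℝ => U *ᵥ n) := by fun_prop
  exact this.measurable

lemma rot_pres {d : ℕ} (U : Matrix (Fin d) (Fin d) ℝ) (hU : Uᵀ * U = 1) :
    MeasurePreserving (fun n : Fin d → ℝ => U *ᵥ n) (gamd d) (gamd d) := by
  have hdet : U.det * U.det = 1 := by
    have := congrArg Matrix.det hU
    simpa using this
  have hne : U.det ≠ 0 := by
    intro h; rw [h] at hdet; simp at hdet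
  have hv : MeasurePreserving (fun n : Fin d → ℝ => U *ᵥ n) volume volume := by
    refine ⟨measurable_mulVec_const U, ?_⟩
    have := Real.map_matrix_volume_pi_eq_smul_volume_pi hne
    have habs : |U.det⁻¹| = 1 := by
      rw [abs_inv]
      have : |U.det| = 1 := by
        have h2 : |U.det| * |U.det| = 1 := by rw [← abs_mul, hdet, abs_one]
        nlinarith [abs_nonneg U.det]
      rw [this, inv_one]
    rw [habs, ENNReal.ofReal_one, one_smul] at this
    have e : ⇑(toLin' U) = fun n => U *ᵥ n := by ext; simp
    rwa [e] at this
  rw [← gaussLaw_one]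
  refine ⟨measurable_mulVec_const U, ?_⟩
  ext s hs
  rw [Measure.map_apply (measurable_mulVec_const U) hs, gaussLaw,
    withDensity_apply _ (measurable_mulVec_const U hs), withDensity_apply _ hs]
  have hm : Measurable fun x : Fin d → ℝ => ENNReal.ofReal (gaussDensity 1 x) := by
    simp only [gaussDensity_one]
    have := measurable_gaussianPDFReal 0 1
    fun_prop
  rw [← hv.setLIntegral_comp_preimage hs hm]
  congr 1
  ext x
  congr 1
  simp only [gaussDensity, inv_one, one_mulVec]
  rw [dotProduct_mulVec, vecMul_mulVec, hU, vecMul_one]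

lemma density_diag {d : ℕ} (S U : Matrix (Fin d) (Fin d) ℝ) (c : Fin d → ℝ) (hS : Sᵀ = S)
    (hdet : S.det ≠ 0) (hU : Uᵀ * U = 1) (hc : ∀ i, 0 < c i) (n : Fin d → ℝ) :
    gaussDensity (S * U * diagonal c * Uᵀ * S) (S *ᵥ n) =
      (√((2 * Real.pi) ^ d * S.det ^ 2))⁻¹ * (∏ i, (√(c i))⁻¹) *
        Real.exp (-(1/2) * ∑ i, (Uᵀ *ᵥ n) i ^ 2 / c i) := by
  have hU' : U * Uᵀ = 1 := mul_eq_one_comm.1 hU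
  have hSu : IsUnit S.det := isUnit_iff_ne_zero.2 hdet
  have hinv : (S * U * diagonal c * Uᵀ * S)⁻¹ = S⁻¹ * U * diagonal (fun i => (c i)⁻¹) * Uᵀ * S⁻¹ := by
    refine inv_eq_right_inv ?_
    have hcc : diagonal c * diagonal (fun i => (c i)⁻¹) = 1 := by
      rw [diagonal_mul_diagonal, ← diagonal_one]
      congr 1; ext i; exact mul_inv_cancel₀ (hc i).ne'
    calc _ = S * U * diagonal c * (Uᵀ * (S * S⁻¹) * U) * diagonal (fun i => (c i)⁻¹) * Uᵀ * S⁻¹ := by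
          noncomm_ring
      _ = S * U * (diagonal c * diagonal (fun i => (c i)⁻¹)) * Uᵀ * S⁻¹ := by
          rw [mul_nonsing_inv _ hSu, mul_one, hU]; noncomm_ring
      _ = S * (U * Uᵀ) * S⁻¹ := by rw [hcc]; noncomm_ring
      _ = 1 := by rw [hU', mul_one, mul_nonsing_inv _ hSu]
  have hUd : U.det * Uᵀ.det = 1 := by rw [← det_mul, hU', det_one]
  have hd : (S * U * diagonal c * Uᵀ * S).det = S.det ^ 2 * ∏ i, c i := by
    simp only [det_mul, det_diagonal]
    calc _ = S.det ^ 2 * (∏ i, c i) * (U.det * Uᵀ.det) := by ring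
      _ = _ := by rw [hUd, mul_one]
  have hq : (S *ᵥ n) ⬝ᵥ (S * U * diagonal c * Uᵀ * S)⁻¹ *ᵥ (S *ᵥ n) = ∑ i, (Uᵀ *ᵥ n) i ^ 2 / c i := by
    rw [hinv]
    have h1 : (S⁻¹ * U * diagonal (fun i => (c i)⁻¹) * Uᵀ * S⁻¹) *ᵥ (S *ᵥ n) =
       (S⁻¹ * U) *ᵥ (diagonal (fun i => (c i)⁻¹) *ᵥ (Uᵀ *ᵥ n)) := by
      simp only [mulVec_mulVec]
      congr 1
      rw [mul_assoc (S⁻¹ * U * diagonal (fun i => (c i)⁻¹) * Uᵀ), nonsing_inv_mul _ hSu]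
      noncomm_ring
    rw [h1, dotProduct_mulVec, ← mulVec_transpose, mulVec_mulVec, transpose_mul, transpose_nonsing_inv, hS,
      mul_assoc, nonsing_inv_mul _ hSu, mul_one, dotProduct]
    refine Finset.sum_congr rfl fun i _ => ?_
    rw [mulVec_diagonal]; ring
  rw [gaussDensity, hq, hd, ← mul_assoc, Real.sqrt_mul (by positivity), mul_inv,
    Real.sqrt_prod _ (fun i _ => (hc i).le), Finset.prod_inv_distrib]

lemma key_diag {d : ℕ} (S D : Matrix (Fin d) (Fin d) ℝ) (hS : Sᵀ = S)
    (hdet : S.det ≠ 0) (hD : Dᵀ = D) :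
    ∃ (U : Matrix (Fin d) (Fin d) ℝ) (b : Fin d → ℝ), Uᵀ * U = 1 ∧ U * Uᵀ = 1 ∧
      S⁻¹ * D * S⁻¹ = U * diagonal b * Uᵀ ∧
      ∀ (n : Fin d → ℝ) (u : ℝ), (∀ i, 0 < 1 + u * b i) →
        gaussDensity (S * S + u • D) (S *ᵥ n) =
          gaussDensity (S * S) (S *ᵥ n) * ∏ i, G1 ((Uᵀ *ᵥ n) i) (u * b i) := by
  have hSu : IsUnit S.det := isUnit_iff_ne_zero.2 hdet
  have hB : (S⁻¹ * D * S⁻¹).IsHermitian := by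
    rw [IsHermitian, conjTranspose_eq_transpose_of_trivial, transpose_mul, transpose_mul,
      transpose_nonsing_inv, hS, hD, mul_assoc]
  have hsp := hB.spectral_theorem
  set U : Matrix (Fin d) (Fin d) ℝ := (hB.eigenvectorUnitary : Matrix (Fin d) (Fin d) ℝ) with hUdef
  have hU : Uᵀ * U = 1 := by
    have := Unitary.coe_star_mul_self hB.eigenvectorUnitary
    rwa [star_eq_conjTranspose, conjTranspose_eq_transpose_of_trivial] at this
  have hU' : U * Uᵀ = 1 := mul_eq_one_comm.1 hU
  have hsp' : S⁻¹ * D * S⁻¹ = U * diagonal hB.eigenvalues * Uᵀ := by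
    rw [Unitary.conjStarAlgAut_apply, star_eq_conjTranspose, conjTranspose_eq_transpose_of_trivial] at hsp
    exact hsp
  generalize hB.eigenvalues = b at hsp'
  refine ⟨U, b, hU, hU', hsp', ?_⟩
  intro n u hu
  have hDD : D = S * (U * diagonal b * Uᵀ) * S := by
    rw [← hsp']
    calc D = (S * S⁻¹) * D * (S⁻¹ * S) := by rw [mul_nonsing_inv _ hSu, nonsing_inv_mul _ hSu]; simp
      _ = _ := by noncomm_ring
  have e1 : S * S + u • D = S * U * diagonal (fun i => 1 + u * b i) * Uᵀ * S := by
    have hdg : diagonal (fun i => 1 + u * b i) = 1 + u • diagonal b := by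
      rw [← diagonal_one, ← diagonal_smul, diagonal_add]; rfl
    rw [hdg]
    calc _ = S * (U * Uᵀ) * S + u • (S * (U * diagonal b * Uᵀ) * S) := by rw [hU', mul_one, ← hDD]
      _ = _ := by
        simp only [mul_add, add_mul, mul_one, Matrix.mul_smul, Matrix.smul_mul]
        simp only [mul_assoc]
  have e0 : S * S = S * U * diagonal (fun _ => 1) * Uᵀ * S := by
    rw [diagonal_one, mul_one, mul_assoc S U, hU', mul_one]
  rw [e1, density_diag S U _ hS hdet hU hu]
  conv_rhs => rw [e0]
  rw [density_diag S U _ hS hdet hU (fun _ => one_pos)]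
  simp only [G1, Finset.prod_mul_distrib, ← Real.exp_sum]
  simp only [Real.sqrt_one, inv_one, Finset.prod_const_one, div_one, mul_one]
  have : ∀ a b c d : ℝ, a * c * (b * d) = a * b * (c * d) := by intros; ring
  rw [this, ← Real.exp_add]
  congr 2
  rw [Finset.mul_sum, Finset.mul_sum, ← Finset.sum_add_distrib]
  refine Finset.sum_congr rfl fun i _ => ?_
  have := (hu i).ne'
  field_simp
  ring


lemma euclNorm_continuous {d : ℕ} : Continuous (euclNorm (d := d)) := by
  unfold euclNorm; fun_prop

lemma sphere_compact (d : ℕ) : IsCompact {x : Fin d → ℝ | euclNorm x = 1} := by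
  refine Metric.isCompact_of_isClosed_isBounded (isClosed_eq euclNorm_continuous continuous_const) ?_
  refine (Metric.isBounded_closedBall (x := (0 : Fin d → ℝ)) (r := 1)).subset ?_
  intro x hx
  rw [mem_closedBall_zero_iff, pi_norm_le_iff_of_nonneg zero_le_one]
  intro i
  have h1 : ∑ j, x j ^ 2 = 1 := by
    have : √(∑ j, x j ^ 2) = 1 := hx
    exact Real.sqrt_eq_one.1 this
  have h2 : x i ^ 2 ≤ ∑ j, x j ^ 2 :=
    Finset.single_le_sum (f := fun j => x j ^ 2) (fun j _ => sq_nonneg _) (Finset.mem_univ i)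
  rw [Real.norm_eq_abs, ← sq_le_one_iff_abs_le_one]
  linarith

lemma sphere_nonempty {d : ℕ} (hd : 1 ≤ d) : {x : Fin d → ℝ | euclNorm x = 1}.Nonempty := by
  refine ⟨Pi.single ⟨0, hd⟩ 1, ?_⟩
  simp [euclNorm, Pi.single_apply]

lemma opNorm_le_iff {d : ℕ} (hd : 1 ≤ d) (M : Matrix (Fin d) (Fin d) ℝ) (r : ℝ) :
    opNorm M ≤ r ↔ ∀ x : Fin d → ℝ, euclNorm x = 1 → euclNorm (M *ᵥ x) ≤ r := by
  have hset : {r : ℝ | ∃ x : Fin d → ℝ, euclNorm x = 1 ∧ r = euclNorm (M.mulVec x)} =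
      (fun x => euclNorm (M *ᵥ x)) '' {x : Fin d → ℝ | euclNorm x = 1} := by
    ext r; simp [eq_comm]
  have hc : Continuous (fun x : Fin d → ℝ => euclNorm (M *ᵥ x)) :=
    euclNorm_continuous.comp (by fun_prop)
  have hb := ((sphere_compact d).image hc).bddAbove
  unfold opNorm
  rw [hset, csSup_le_iff hb ((sphere_nonempty hd).image _)]
  simp

lemma lambdaMin_spec {d : ℕ} (hd : 1 ≤ d) (K : Matrix (Fin d) (Fin d) ℝ) (hK : K.PosDef) :
    0 < lambdaMin K ∧ ∀ x : Fin d → ℝ, euclNorm x = 1 → lambdaMin K ≤ x ⬝ᵥ K *ᵥ x := by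
  have hset : {r : ℝ | ∃ x : Fin d → ℝ, euclNorm x = 1 ∧ r = x ⬝ᵥ K.mulVec x} =
      (fun x => x ⬝ᵥ K *ᵥ x) '' {x : Fin d → ℝ | euclNorm x = 1} := by
    ext r; simp [eq_comm]
  have hc : Continuous (fun x : Fin d → ℝ => x ⬝ᵥ K *ᵥ x) := by fun_prop
  have hcomp := (sphere_compact d).image hc
  unfold lambdaMin
  rw [hset]
  constructor
  · obtain ⟨x, hx, hxe⟩ := hcomp.sInf_mem ((sphere_nonempty hd).image _)
    rw [← hxe]
    have hx0 : x ≠ 0 := by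
      rintro rfl
      simp [euclNorm] at hx
    simpa using (posDef_iff_dotProduct_mulVec.1 hK).2 hx0
  · intro x hx
    exact csInf_le hcomp.bddBelow ⟨x, hx, rfl⟩

lemma cs_euclNorm {d : ℕ} (x y : Fin d → ℝ) : |x ⬝ᵥ y| ≤ euclNorm x * euclNorm y := by
  unfold euclNorm
  rw [← Real.sqrt_mul (by positivity)]
  refine Real.abs_le_sqrt ?_
  exact Finset.sum_mul_sq_le_sq_mul_sq _ _ _

lemma Gam_posDef {d : ℕ} (hd : 1 ≤ d) (K A : Matrix (Fin d) (Fin d) ℝ) (hK : K.PosDef)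
    (hA : Aᵀ = A) (hE : opNorm (A - K) ≤ lambdaMin K / 2) (s : ℝ) (hs : |s| < 2) :
    (Gam A K s).PosDef := by
  have hKt : Kᵀ = K := by
    have := hK.1
    rwa [IsHermitian, conjTranspose_eq_transpose_of_trivial] at this
  refine PosDef.of_dotProduct_mulVec_pos ?_ ?_
  · rw [IsHermitian, conjTranspose_eq_transpose_of_trivial]
    simp [Gam, hA, hKt]
  obtain ⟨hl, hl'⟩ := lambdaMin_spec hd K hK
  rw [opNorm_le_iff hd] at hE
  have hunit : ∀ x : Fin d → ℝ, euclNorm x = 1 → 0 < x ⬝ᵥ Gam A K s *ᵥ x := by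
    intro x hx
    have e : Gam A K s = K + s • (A - K) := by
      unfold Gam; module
    rw [e, add_mulVec, dotProduct_add, smul_mulVec, dotProduct_smul, smul_eq_mul]
    have h1 := hl' x hx
    have h2 : |x ⬝ᵥ (A - K) *ᵥ x| ≤ lambdaMin K / 2 := by
      refine (cs_euclNorm _ _).trans ?_
      rw [hx, one_mul]; exact hE x hx
    have h3 : |s * (x ⬝ᵥ (A - K) *ᵥ x)| ≤ |s| * (lambdaMin K / 2) := by
      rw [abs_mul]; gcongr
    have h4 := neg_abs_le (s * (x ⬝ᵥ (A - K) *ᵥ x))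
    nlinarith
  intro x hx
  have hr : 0 < euclNorm x := by
    unfold euclNorm
    refine Real.sqrt_pos.2 ?_
    obtain ⟨i, hi⟩ := Function.ne_iff.1 hx
    refine Finset.sum_pos' (fun i _ => sq_nonneg _) ⟨i, Finset.mem_univ i, ?_⟩
    have : x i ≠ 0 := hi
    positivity
  have hu := hunit ((euclNorm x)⁻¹ • x) (by
    have : euclNorm ((euclNorm x)⁻¹ • x) = |(euclNorm x)⁻¹| * euclNorm x := by
      conv_lhs => rw [euclNorm]
      simp only [Pi.smul_apply, smul_eq_mul, mul_pow, ← Finset.mul_sum]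
      rw [Real.sqrt_mul (sq_nonneg _), Real.sqrt_sq_eq_abs]; rfl
    rw [this, abs_of_pos (inv_pos.2 hr), inv_mul_cancel₀ hr.ne'])
  rw [mulVec_smul, dotProduct_smul, smul_dotProduct, smul_eq_mul, smul_eq_mul, ← mul_assoc] at hu
  have hi : 0 < (euclNorm x)⁻¹ * (euclNorm x)⁻¹ := by positivity
  simpa using (pos_iff_pos_of_mul_pos hu).1 hi

open scoped MatrixOrder in
lemma exists_sqrt {d : ℕ} (M : Matrix (Fin d) (Fin d) ℝ) (hM : M.PosSemidef) :
    (CFC.sqrt M).PosSemidef ∧ CFC.sqrt M * CFC.sqrt M = M := by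
  refine ⟨(CFC.sqrt_nonneg M).posSemidef, CFC.sqrt_mul_sqrt_self M hM.nonneg⟩

open scoped MatrixOrder in
lemma sqrt_uniq {d : ℕ} (M S : Matrix (Fin d) (Fin d) ℝ) (hS : S.PosSemidef) (h : S * S = M) :
    CFC.sqrt M = S := CFC.sqrt_unique h hS.nonneg

lemma psd_transpose {d : ℕ} {S : Matrix (Fin d) (Fin d) ℝ} (hS : S.PosSemidef) : Sᵀ = S := by
  have := hS.1
  rwa [IsHermitian, conjTranspose_eq_transpose_of_trivial] at this

lemma gaussDensity_ne {d : ℕ} (M : Matrix (Fin d) (Fin d) ℝ) (h : 0 < M.det) (x : Fin d → ℝ) :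
    gaussDensity M x ≠ 0 := by
  unfold gaussDensity; positivity

lemma gfun_local {d : ℕ} (A K S : Matrix (Fin d) (Fin d) ℝ) (t : ℝ) (hK : K.PosDef) (hA : Aᵀ = A)
    (hS : Sᵀ = S) (hdet : S.det ≠ 0) (hSS : S * S = Gam A K t) :
    ∃ (U : Matrix (Fin d) (Fin d) ℝ) (b : Fin d → ℝ), Uᵀ * U = 1 ∧ U * Uᵀ = 1 ∧
      S⁻¹ * (A - K) * S⁻¹ = U * diagonal b * Uᵀ ∧
      ∀ (n : Fin d → ℝ), ∀ᶠ s in nhds t, gfun A K s (S *ᵥ n) =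
        gfun A K t (S *ᵥ n) * ∏ i, G1 ((Uᵀ *ᵥ n) i) ((s - t) * b i) := by
  have hKt : Kᵀ = K := psd_transpose hK.posSemidef
  obtain ⟨U, b, h1, h2, h3, h4⟩ := key_diag S (A - K) hS hdet (by simp [hA, hKt])
  refine ⟨U, b, h1, h2, h3, fun n => ?_⟩
  have hev : ∀ᶠ s in nhds t, ∀ i, 0 < 1 + (s - t) * b i := by
    rw [Filter.eventually_all]
    intro i
    have hc : Continuous (fun s : ℝ => 1 + (s - t) * b i) := by fun_prop
    exact hc.continuousAt.eventually (lt_mem_nhds (by simp))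
  filter_upwards [hev] with s hs
  have e : Gam A K s = S * S + (s - t) • (A - K) := by
    rw [hSS]; unfold Gam; module
  unfold gfun
  rw [e, h4 n (s - t) hs, hSS]
  ring

open scoped MatrixOrder in
lemma gfun_contDiffAt {d : ℕ} (hd : 1 ≤ d) (K A : Matrix (Fin d) (Fin d) ℝ) (hK : K.PosDef)
    (hA : Aᵀ = A) (hE : opNorm (A - K) ≤ lambdaMin K / 2) (s : ℝ) (hs : |s| < 2)
    (x : Fin d → ℝ) (m : ℕ) : ContDiffAt ℝ m (fun s => gfun A K s x) s := by
  have hpd := Gam_posDef hd K A hK hA hE s hs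
  obtain ⟨hS, hSS⟩ := exists_sqrt _ hpd.posSemidef
  set S := CFC.sqrt (Gam A K s)
  have hdet : S.det ≠ 0 := by
    intro h
    have := hpd.det_pos
    rw [← hSS, det_mul, h] at this
    simp at this
  obtain ⟨U, b, -, -, -, h4⟩ := gfun_local A K S s hK hA (psd_transpose hS) hdet hSS
  have hx : S *ᵥ (S⁻¹ *ᵥ x) = x := by
    rw [mulVec_mulVec, mul_nonsing_inv _ (isUnit_iff_ne_zero.2 hdet), one_mulVec]
  have := h4 (S⁻¹ *ᵥ x)
  rw [hx] at this
  refine ContDiffAt.congr_of_eventuallyEq ?_ this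
  refine contDiffAt_const.mul (contDiffAt_prod fun i _ => ?_)
  have hg := G1_contDiffAt ((Uᵀ *ᵥ (S⁻¹ *ᵥ x)) i) (b i) (s - s) (by simp) m
  exact ContDiffAt.comp s (g := fun s => G1 ((Uᵀ *ᵥ (S⁻¹ *ᵥ x)) i) (s * b i)) (f := fun s' => s' - s)
    hg (by fun_prop)

lemma fixed_formula {d : ℕ} (A K S : Matrix (Fin d) (Fin d) ℝ) (t : ℝ) (hK : K.PosDef) (hA : Aᵀ = A)
    (hS : Sᵀ = S) (hSS : S * S = Gam A K t) (hpd : (Gam A K t).PosDef) (k : ℕ) :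
    ∃ (U : Matrix (Fin d) (Fin d) ℝ) (b : Fin d → ℝ), U * Uᵀ = 1 ∧
      ∀ n : Fin d → ℝ, hfun k A K t (S *ᵥ n) = hpoly b k (Uᵀ *ᵥ n) ∧
        n ⬝ᵥ (S⁻¹ * (A - K) * (Gam A K t)⁻¹ * (A - K) * S⁻¹) *ᵥ n =
          ∑ i, b i ^ 2 * (Uᵀ *ᵥ n) i ^ 2 := by
  have hdet : S.det ≠ 0 := by
    intro h
    have := hpd.det_pos
    rw [← hSS, det_mul, h] at this
    simp at this
  obtain ⟨U, b, h1, h2, h3, h4⟩ := gfun_local A K S t hK hA hS hdet hSS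
  refine ⟨U, b, h2, fun n => ⟨?_, ?_⟩⟩
  · unfold hfun
    have hne : gfun A K t (S *ᵥ n) ≠ 0 :=
      div_ne_zero (gaussDensity_ne _ hpd.det_pos _) (gaussDensity_ne _ hK.det_pos _)
    rw [div_eq_iff hne, Filter.EventuallyEq.iteratedDeriv_eq k (h4 n)]
    have hsh := congrFun (iteratedDeriv_comp_add_const k
      (fun s => gfun A K t (S *ᵥ n) * ∏ i, G1 ((Uᵀ *ᵥ n) i) ((s - t) * b i)) t) 0
    simp only [zero_add, add_sub_cancel_right] at hsh
    rw [← hsh, iteratedDeriv_const_mul, iterDeriv_G, mul_comm]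
    exact contDiffAt_prod fun i _ => G1_contDiffAt _ _ _ (by simp) _
  · have hinv : (Gam A K t)⁻¹ = S⁻¹ * S⁻¹ := by rw [← hSS, Matrix.mul_inv_rev]
    have e : S⁻¹ * (A - K) * (Gam A K t)⁻¹ * (A - K) * S⁻¹ = U * diagonal (fun i => b i ^ 2) * Uᵀ := by
      rw [hinv]
      calc _ = (S⁻¹ * (A - K) * S⁻¹) * (S⁻¹ * (A - K) * S⁻¹) := by noncomm_ring
        _ = U * diagonal b * (Uᵀ * U) * diagonal b * Uᵀ := by rw [h3]; noncomm_ring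
        _ = U * (diagonal b * diagonal b) * Uᵀ := by rw [h1]; noncomm_ring
        _ = _ := by rw [diagonal_mul_diagonal]; simp only [sq]
    rw [e, ← mulVec_mulVec, ← mulVec_mulVec, dotProduct_mulVec, ← mulVec_transpose, dotProduct]
    refine Finset.sum_congr rfl fun i _ => ?_
    rw [mulVec_diagonal]; ring

lemma hpoly_measurable {d : ℕ} (b : Fin d → ℝ) (k : ℕ) : Measurable (hpoly b k) := by
  have : Continuous (hpoly b k) := by
    unfold hpoly
    refine continuous_const.mul (continuous_finsetSum _ fun α _ => continuous_finsetProd _ fun i _ => ?_)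
    exact continuous_const.mul ((Polynomial.continuous _).comp (continuous_apply i))
  exact this.measurable

lemma fixed_lintegral {d : ℕ} (A K S : Matrix (Fin d) (Fin d) ℝ) (t : ℝ) (hK : K.PosDef) (hA : Aᵀ = A)
    (hS : Sᵀ = S) (hSS : S * S = Gam A K t) (hpd : (Gam A K t).PosDef) (k : ℕ) :
    ∫⁻ n, ENNReal.ofReal (hfun k A K t (S *ᵥ n) ^ 2) ∂(gamd d) =
    ENNReal.ofReal ((k.factorial : ℝ) / 2 ^ k) *
      ∫⁻ n, ENNReal.ofReal ((n ⬝ᵥ (S⁻¹ * (A - K) * (Gam A K t)⁻¹ * (A - K) * S⁻¹) *ᵥ n) ^ k) ∂(gamd d) := by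
  obtain ⟨U, b, hU, h⟩ := fixed_formula A K S t hK hA hS hSS hpd k
  have hm := rot_pres Uᵀ (by simpa using hU)
  simp only [fun n => (h n).1, fun n => (h n).2]
  have hm2 : Measurable fun y : Fin d → ℝ => (∑ i, b i ^ 2 * y i ^ 2) ^ k := by fun_prop
  rw [hm.lintegral_comp (f := fun y => ENNReal.ofReal (hpoly b k y ^ 2))
      ((hpoly_measurable b k).pow_const 2).ennreal_ofReal,
    hm.lintegral_comp (f := fun y => ENNReal.ofReal ((∑ i, b i ^ 2 * y i ^ 2) ^ k))
      hm2.ennreal_ofReal,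
    ← ofReal_integral_eq_lintegral_ofReal (core_lhs b k).1 (Filter.Eventually.of_forall fun y => by positivity),
    ← ofReal_integral_eq_lintegral_ofReal (core_rhs b k).1 (Filter.Eventually.of_forall fun y => by positivity),
    ← ENNReal.ofReal_mul (by positivity), core_eq]

lemma measurable_iteratedDeriv_param {α : Type*} [MeasurableSpace α] (f : α → ℝ → ℝ)
    (hmeas : ∀ s, |s| < 2 → Measurable fun a => f a s)
    (hdiff : ∀ a s, |s| < 2 → ∀ m : ℕ, ContDiffAt ℝ m (f a) s) (k : ℕ) :
    ∀ s, |s| < 2 → Measurable fun a => iteratedDeriv k (f a) s := by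
  induction k with
  | zero => intro s hs; simpa using hmeas s hs
  | succ k ih =>
    intro s hs
    obtain ⟨ε, hε, hεs⟩ : ∃ ε : ℝ, 0 < ε ∧ |s| + ε < 2 := ⟨(2 - |s|) / 2, by linarith, by linarith⟩
    have hin : ∀ n : ℕ, |s + ε * (1 / ((n:ℝ) + 1))| < 2 := by
      intro n
      have h1 : 1 / ((n:ℝ) + 1) ≤ 1 := by
        rw [div_le_one (by positivity)]; linarith [n.cast_nonneg (α := ℝ)]
      have h0 : 0 < 1 / ((n:ℝ) + 1) := by positivity
      have := abs_add_le s (ε * (1 / ((n:ℝ) + 1)))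
      rw [abs_of_pos (mul_pos hε h0)] at this
      nlinarith
    refine measurable_of_tendsto_metrizable (f := fun (n : ℕ) a =>
      (ε * (1 / ((n:ℝ) + 1)))⁻¹ * (iteratedDeriv k (f a) (s + ε * (1 / ((n:ℝ) + 1))) - iteratedDeriv k (f a) s))
      (fun n => ((ih _ (hin n)).sub (ih s hs)).const_mul _) ?_
    rw [tendsto_pi_nhds]
    intro a
    have hd : HasDerivAt (iteratedDeriv k (f a)) (iteratedDeriv (k + 1) (f a) s) s := by
      rw [iteratedDeriv_succ]
      refine DifferentiableAt.hasDerivAt ?_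
      rw [← differentiableWithinAt_univ]
      simp only [← iteratedDerivWithin_univ]
      refine ContDiffWithinAt.differentiableWithinAt_iteratedDerivWithin (n := ((k + 1 : ℕ) : WithTop ℕ∞)) (hdiff a s hs (k + 1)).contDiffWithinAt (by exact_mod_cast Nat.lt_succ_self k) (by simpa using uniqueDiffOn_univ)
    have ht := hasDerivAt_iff_tendsto_slope_zero.1 hd
    have hseq : Filter.Tendsto (fun n : ℕ => ε * (1 / ((n:ℝ) + 1))) Filter.atTop (nhdsWithin 0 {0}ᶜ) := by
      rw [tendsto_nhdsWithin_iff]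
      refine ⟨by simpa using tendsto_one_div_add_atTop_nhds_zero_nat.const_mul ε, ?_⟩
      filter_upwards with n
      have : 0 < ε * (1 / ((n:ℝ) + 1)) := by positivity
      exact this.ne'
    have hfin := ht.comp hseq
    simp only [smul_eq_mul, Function.comp_def] at hfin
    exact hfin


/-- entrywise measurability -/
def MM {α : Type*} [MeasurableSpace α] {d : ℕ} (X : α → Matrix (Fin d) (Fin d) ℝ) : Prop :=
  ∀ i j, Measurable fun a => X a i j

section
variable {α : Type*} [MeasurableSpace α] {d : ℕ} {X Y : α → Matrix (Fin d) (Fin d) ℝ}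

lemma MM.mul (hX : MM X) (hY : MM Y) : MM fun a => X a * Y a := by
  intro i j
  simp only [mul_apply]
  exact Finset.measurable_fun_sum _ fun l _ => (hX i l).mul (hY l j)

lemma MM.add (hX : MM X) (hY : MM Y) : MM fun a => X a + Y a := fun i j => (hX i j).add (hY i j)

lemma MM.sub (hX : MM X) (hY : MM Y) : MM fun a => X a - Y a := fun i j => (hX i j).sub (hY i j)

lemma MM.smul (hX : MM X) (c : ℝ) : MM fun a => c • X a := fun i j => (hX i j).const_mul c

lemma MM.const (M : Matrix (Fin d) (Fin d) ℝ) : MM fun _ : α => M := fun _ _ => measurable_const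

lemma MM.det (hX : MM X) : Measurable fun a => (X a).det := by
  simp only [det_apply']
  exact Finset.measurable_fun_sum _ fun l _ => measurable_const.mul
    (Finset.measurable_fun_prod _ fun i _ => hX _ _)

lemma MM.inv (hX : MM X) : MM fun a => (X a)⁻¹ := by
  intro i j
  simp only [inv_def, Matrix.smul_apply, adjugate_apply, Ring.inverse_eq_inv', smul_eq_mul]
  refine hX.det.inv.mul (MM.det fun p q => ?_)
  simp only [updateRow_apply]
  split_ifs
  · exact measurable_const
  · exact hX p q

lemma MM.mulVec (hX : MM X) {v : α → Fin d → ℝ} (hv : Measurable v) :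
    Measurable fun a => X a *ᵥ v a := by
  rw [measurable_pi_iff]
  intro i
  simp only [Matrix.mulVec, dotProduct]
  exact Finset.measurable_fun_sum _ fun l _ => (hX i l).mul ((measurable_pi_apply l).comp hv)

lemma measurable_dot {u v : α → Fin d → ℝ} (hu : Measurable u) (hv : Measurable v) :
    Measurable fun a => u a ⬝ᵥ v a := by
  simp only [dotProduct]
  exact Finset.measurable_fun_sum _ fun l _ =>
    ((measurable_pi_apply l).comp hu).mul ((measurable_pi_apply l).comp hv)

lemma MM.gaussDensity (hX : MM X) {v : α → Fin d → ℝ} (hv : Measurable v) :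
    Measurable fun a => gaussDensity (X a) (v a) := by
  unfold _root_.gaussDensity
  have h1 := hX.det
  have h2 := measurable_dot hv (hX.inv.mulVec hv)
  exact ((h1.const_mul _).sqrt.inv).mul ((h2.const_mul _).exp)

lemma MM.Gam (hX : MM X) (K : Matrix (Fin d) (Fin d) ℝ) (s : ℝ) : MM fun a => Gam (X a) K s := by
  unfold _root_.Gam
  exact (hX.smul s).add (MM.const _)

lemma MM.gfun (hX : MM X) (K : Matrix (Fin d) (Fin d) ℝ) (s : ℝ) {v : α → Fin d → ℝ}
    (hv : Measurable v) : Measurable fun a => gfun (X a) K s (v a) := by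
  unfold _root_.gfun
  exact ((hX.Gam K s).gaussDensity hv).div ((MM.const K).gaussDensity hv)
end

lemma psd_closed {d : ℕ} : IsClosed {a : Matrix (Fin d) (Fin d) ℝ | a.PosSemidef} := by
  simp only [posSemidef_iff_dotProduct_mulVec, Set.ofPred_and, Set.ofPred_forall]
  refine IsClosed.inter ?_ (isClosed_iInter fun x => ?_)
  · simp only [IsHermitian]
    exact isClosed_eq (by fun_prop) (by fun_prop)
  · exact isClosed_le continuous_const (by fun_prop)

lemma op_closed {d : ℕ} (hd : 1 ≤ d) (K : Matrix (Fin d) (Fin d) ℝ) (r : ℝ) :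
    IsClosed {a : Matrix (Fin d) (Fin d) ℝ | opNorm (a - K) ≤ r} := by
  simp only [opNorm_le_iff hd, Set.ofPred_forall]
  refine isClosed_iInter fun x => isClosed_iInter fun _ => ?_
  refine isClosed_le (euclNorm_continuous.comp ?_) continuous_const
  fun_prop

lemma Gam_psd {d : ℕ} (K : Matrix (Fin d) (Fin d) ℝ) (hK : K.PosDef) (t : ℝ)
    (ht : t ∈ Set.Icc (0 : ℝ) 1) (a : Matrix (Fin d) (Fin d) ℝ) (ha : a.PosSemidef) :
    (Gam a K t).PosSemidef :=
  (ha.smul ht.1).add (hK.posSemidef.smul (by linarith [ht.2]))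

open Classical in
open scoped MatrixOrder Matrix.Norms.L2Operator in
lemma sigma_exists {d : ℕ} (K : Matrix (Fin d) (Fin d) ℝ) (hK : K.PosDef) (t : ℝ)
    (ht : t ∈ Set.Icc (0 : ℝ) 1) :
    ∃ σ : (Fin d → Fin d → ℝ) → Matrix (Fin d) (Fin d) ℝ, MM σ ∧
      ∀ a : Matrix (Fin d) (Fin d) ℝ, a.PosSemidef → ∀ S : Matrix (Fin d) (Fin d) ℝ,
        S.PosSemidef → S * S = Gam a K t → σ a = S := by
  refine ⟨fun a => if (Matrix.of a).PosSemidef then CFC.sqrt (Gam (Matrix.of a) K t) else 0, ?_, ?_⟩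
  · intro i j
    have hc : ContinuousOn (fun a : Matrix (Fin d) (Fin d) ℝ => CFC.sqrt (Gam a K t) i j)
        {a | a.PosSemidef} := by
      have h1 : ContinuousOn CFC.sqrt {a : Matrix (Fin d) (Fin d) ℝ | 0 ≤ a} := CFC.continuousOn_sqrt
      have h2 : Continuous fun a : Matrix (Fin d) (Fin d) ℝ => Gam a K t := by
        unfold Gam; fun_prop
      have h3 := h1.comp h2.continuousOn (s := {a : Matrix (Fin d) (Fin d) ℝ | a.PosSemidef})
        (fun a ha => (Gam_psd K hK t ht a ha).nonneg)
      exact (continuous_apply_apply i j).comp_continuousOn h3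
    have hc1 : ContinuousOn (fun a : Fin d → Fin d → ℝ => CFC.sqrt (Gam (Matrix.of a) K t) i j)
        {a | (Matrix.of a).PosSemidef} := hc
    have hcl : IsClosed {a : Fin d → Fin d → ℝ | (Matrix.of a).PosSemidef} := psd_closed
    have hm : Measurable (({a : Fin d → Fin d → ℝ | (Matrix.of a).PosSemidef}).piecewise
        (fun a : Fin d → Fin d → ℝ => CFC.sqrt (Gam (Matrix.of a) K t) i j) (fun _ => (0:ℝ))) :=
      ContinuousOn.measurable_piecewise hc1 continuousOn_const hcl.measurableSet
    convert hm using 2 with a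
    simp only [Set.piecewise, Set.mem_ofPred_eq]
    split_ifs <;> rfl
  · intro a ha S hS h
    have : (if (Matrix.of a).PosSemidef then CFC.sqrt (Gam (Matrix.of a) K t) else 0) = S := by
      rw [if_pos (show (Matrix.of a).PosSemidef from ha)]
      exact sqrt_uniq _ _ hS h
    exact this

lemma final_meas {d : ℕ} (hd : 1 ≤ d) (K : Matrix (Fin d) (Fin d) ℝ) (hK : K.PosDef)
    (σ : (Fin d → Fin d → ℝ) → Matrix (Fin d) (Fin d) ℝ) (hσ : MM σ)
    (C : Set (Fin d → Fin d → ℝ)) (hC : MeasurableSet C) [∀ a, Decidable (a ∈ C)]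
    (hCP : ∀ a ∈ C, (Matrix.of a)ᵀ = Matrix.of a ∧ opNorm (Matrix.of a - K) ≤ lambdaMin K / 2)
    (k : ℕ) (t : ℝ) (ht : |t| < 2) :
    Measurable fun p : (Fin d → ℝ) × (Fin d → Fin d → ℝ) =>
      if p.2 ∈ C then hfun k (Matrix.of p.2) K t (σ p.2 *ᵥ p.1) ^ 2 else 0 := by
  have hX : MM fun p : (Fin d → ℝ) × (Fin d → Fin d → ℝ) => Matrix.of p.2 := fun i j => by
    simp only [of_apply]; fun_prop
  have hs2 : MM fun p : (Fin d → ℝ) × (Fin d → Fin d → ℝ) => σ p.2 :=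
    fun i j => (hσ i j).comp measurable_snd
  have hv := hs2.mulVec measurable_fst
  have hCm : MeasurableSet {p : (Fin d → ℝ) × (Fin d → Fin d → ℝ) | p.2 ∈ C} := measurable_snd hC
  have hg := fun s => hX.gfun K s hv
  have hD := measurable_iteratedDeriv_param
    (fun (p : (Fin d → ℝ) × (Fin d → Fin d → ℝ)) s =>
      if p.2 ∈ C then gfun (Matrix.of p.2) K s (σ p.2 *ᵥ p.1) else 0)
    (fun s _ => Measurable.ite hCm (hg s) measurable_const)
    (fun p s hs m => by
      by_cases hp : p.2 ∈ C
      · simp only [hp, if_true]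
        exact gfun_contDiffAt hd K _ hK (hCP _ hp).1 (hCP _ hp).2 s hs _ m
      · simp only [hp, if_false]
        exact contDiffAt_const) k t ht
  have hfin : Measurable fun p : (Fin d → ℝ) × (Fin d → Fin d → ℝ) => if p.2 ∈ C then
      (iteratedDeriv k (fun s => if p.2 ∈ C then gfun (Matrix.of p.2) K s (σ p.2 *ᵥ p.1) else 0) t /
        gfun (Matrix.of p.2) K t (σ p.2 *ᵥ p.1)) ^ 2 else (0 : ℝ) :=
    Measurable.ite hCm ((hD.div (hg t)).pow_const 2) measurable_const
  convert hfin using 2 with p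
  by_cases hp : p.2 ∈ C
  · simp only [hp, if_true]; rfl
  · simp only [hp, if_false]

/-- Proposition `var_hk`: second moment of `h_k(A,t,F_t)` on the event `E`. -/
theorem statement_10
    {d : ℕ} (hd : 1 ≤ d)
    {Ω : Type*} [mΩ : MeasurableSpace Ω] (P : Measure Ω) [IsProbabilityMeasure P]
    (K : Matrix (Fin d) (Fin d) ℝ) (hK : K.PosDef)
    (A : Ω → Matrix (Fin d) (Fin d) ℝ) (hA : ∀ ω, (A ω).PosSemidef)
    (hAmeas : Measurable fun ω i j => A ω i j)
    (N : Ω → Fin d → ℝ) (hN : Measure.map N P = gaussLaw (1 : Matrix (Fin d) (Fin d) ℝ))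
    (hInd : IndepFun N (fun ω i j => A ω i j) P)
    (k : ℕ) (hk : 1 ≤ k)
    (hmom : Integrable (fun ω => hsNorm (A ω) ^ (2 * k)) P)
    (t : ℝ) (ht : t ∈ Set.Icc (0 : ℝ) 1)
    (S : Ω → Matrix (Fin d) (Fin d) ℝ)
    (hS : ∀ ω, (S ω).PosSemidef ∧ S ω * S ω = Gam (A ω) K t) :
    (∫ ω in EvSet A K, hfun k (A ω) K t ((S ω).mulVec (N ω)) ^ 2 ∂P) =
      ((Nat.factorial k : ℝ) / 2 ^ k) *
        ∫ ω in EvSet A K,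
          (N ω ⬝ᵥ ((S ω)⁻¹ * (A ω - K) * (Gam (A ω) K t)⁻¹ * (A ω - K) * (S ω)⁻¹).mulVec
            (N ω)) ^ k ∂P := by
  classical
  have htl : |t| < 2 := by rw [abs_of_nonneg ht.1]; linarith [ht.2]
  obtain ⟨σ, hσ, hσu⟩ := sigma_exists K hK t ht
  set C : Set (Fin d → Fin d → ℝ) :=
    {a | (Matrix.of a).PosSemidef ∧ opNorm (Matrix.of a - K) ≤ lambdaMin K / 2} with hCdef
  have hcl1 : IsClosed {a : Fin d → Fin d → ℝ | (Matrix.of a).PosSemidef} := psd_closed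
  have hcl2 : IsClosed {a : Fin d → Fin d → ℝ | opNorm (Matrix.of a - K) ≤ lambdaMin K / 2} :=
    op_closed hd K _
  have hC : MeasurableSet C := (hcl1.inter hcl2).measurableSet
  have hCP : ∀ a ∈ C, (Matrix.of a)ᵀ = Matrix.of a ∧ opNorm (Matrix.of a - K) ≤ lambdaMin K / 2 :=
    fun a ha => ⟨psd_transpose ha.1, ha.2⟩
  set F1 : (Fin d → ℝ) × (Fin d → Fin d → ℝ) → ℝ := fun p =>
      if p.2 ∈ C then hfun k (Matrix.of p.2) K t (σ p.2 *ᵥ p.1) ^ 2 else 0 with hF1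
  set F2 : (Fin d → ℝ) × (Fin d → Fin d → ℝ) → ℝ := fun p =>
      if p.2 ∈ C then (p.1 ⬝ᵥ ((σ p.2)⁻¹ * (Matrix.of p.2 - K) * (Gam (Matrix.of p.2) K t)⁻¹ *
        (Matrix.of p.2 - K) * (σ p.2)⁻¹) *ᵥ p.1) ^ k else 0 with hF2
  have hF1m : Measurable F1 := final_meas hd K hK σ hσ C hC hCP k t htl
  have hX : MM fun p : (Fin d → ℝ) × (Fin d → Fin d → ℝ) => Matrix.of p.2 := fun i j => by
    simp only [of_apply]; fun_prop
  have hs2 : MM fun p : (Fin d → ℝ) × (Fin d → Fin d → ℝ) => σ p.2 :=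
    fun i j => (hσ i j).comp measurable_snd
  have hCm : MeasurableSet {p : (Fin d → ℝ) × (Fin d → Fin d → ℝ) | p.2 ∈ C} := measurable_snd hC
  have hF2m : Measurable F2 := by
    refine Measurable.ite hCm (Measurable.pow_const (measurable_dot measurable_fst
      (MM.mulVec ?_ measurable_fst)) k) measurable_const
    exact (((hs2.inv.mul (hX.sub (MM.const K))).mul (hX.Gam K t).inv).mul
      (hX.sub (MM.const K))).mul hs2.inv
  -- facts for fixed matrices
  have hσs : ∀ a ∈ C, (σ a)ᵀ = σ a ∧ σ a * σ a = Gam (Matrix.of a) K t ∧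
      (Gam (Matrix.of a) K t).PosDef := by
    intro a ha
    have h := exists_sqrt _ (Gam_psd K hK t ht _ ha.1)
    have h2 : σ a = _ := hσu (Matrix.of a) ha.1 _ h.1 h.2
    rw [h2]
    exact ⟨psd_transpose h.1, h.2, Gam_posDef hd K _ hK (hCP a ha).1 ha.2 t htl⟩
  have hF1n : ∀ p, 0 ≤ F1 p := fun p => by
    simp only [hF1]; split_ifs
    · positivity
    · exact le_rfl
  have hF2n : ∀ p, 0 ≤ F2 p := fun p => by
    simp only [hF2]; split_ifs with hp
    · obtain ⟨h1, h2, h3⟩ := hσs _ hp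
      obtain ⟨U, b, -, h⟩ := fixed_formula (Matrix.of p.2) K (σ p.2) t hK (hCP _ hp).1 h1 h2 h3 k
      rw [(h p.1).2]
      positivity
    · exact le_rfl
  have hN0 : Measure.map N P = gamd d := by rw [hN, gaussLaw_one]
  have hNm : AEMeasurable N P := by
    by_contra hcon
    rw [Measure.map_of_not_aemeasurable hcon] at hN0
    exact IsProbabilityMeasure.ne_zero (gamd d) hN0.symm
  have hpair : AEMeasurable (fun ω => (N ω, fun i j => A ω i j)) P := hNm.prodMk hAmeas.aemeasurable
  have hlaw := (indepFun_iff_map_prod_eq_prod_map_map hNm hAmeas.aemeasurable).1 hInd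
  rw [hN0] at hlaw
  have hEv : MeasurableSet (EvSet A K) := hAmeas hcl2.measurableSet
  have hmem : ∀ ω, (fun i j => A ω i j) ∈ C ↔ ω ∈ EvSet A K := fun ω =>
    ⟨fun h => h.2, fun h => ⟨hA ω, h⟩⟩
  have hSσ : ∀ ω, σ (fun i j => A ω i j) = S ω := fun ω =>
    hσu (A ω) (hA ω) _ (hS ω).1 (hS ω).2
  have hL : (∫ ω in EvSet A K, hfun k (A ω) K t ((S ω).mulVec (N ω)) ^ 2 ∂P) =
      ∫ ω, F1 (N ω, fun i j => A ω i j) ∂P := by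
    rw [← integral_indicator hEv]
    refine integral_congr_ae (Filter.Eventually.of_forall fun ω => ?_)
    simp only [hF1, Set.indicator_apply, hmem, hSσ]
    rfl
  have hR : (∫ ω in EvSet A K,
          (N ω ⬝ᵥ ((S ω)⁻¹ * (A ω - K) * (Gam (A ω) K t)⁻¹ * (A ω - K) * (S ω)⁻¹).mulVec
            (N ω)) ^ k ∂P) = ∫ ω, F2 (N ω, fun i j => A ω i j) ∂P := by
    rw [← integral_indicator hEv]
    refine integral_congr_ae (Filter.Eventually.of_forall fun ω => ?_)
    simp only [hF2, Set.indicator_apply, hmem, hSσ]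
    rfl
  have conv : ∀ F : (Fin d → ℝ) × (Fin d → Fin d → ℝ) → ℝ, Measurable F → (∀ p, 0 ≤ F p) →
      ∫ ω, F (N ω, fun i j => A ω i j) ∂P =
      (∫⁻ a, ∫⁻ n, ENNReal.ofReal (F (n, a)) ∂(gamd d)
        ∂(Measure.map (fun ω i j => A ω i j) P)).toReal := by
    intro F hF hFn
    have : IsProbabilityMeasure (Measure.map (fun ω i j => A ω i j) P) :=
      Measure.isProbabilityMeasure_map hAmeas.aemeasurable
    rw [← integral_map hpair hF.aestronglyMeasurable, hlaw,
      integral_eq_lintegral_of_nonneg_ae (Filter.Eventually.of_forall hFn)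
        hF.aestronglyMeasurable, lintegral_prod_symm _ hF.ennreal_ofReal.aemeasurable]
  rw [hL, hR, conv F1 hF1m hF1n, conv F2 hF2m hF2n]
  have key : ∀ a, ∫⁻ n, ENNReal.ofReal (F1 (n, a)) ∂(gamd d) =
      ENNReal.ofReal ((k.factorial : ℝ) / 2 ^ k) * ∫⁻ n, ENNReal.ofReal (F2 (n, a)) ∂(gamd d) := by
    intro a
    by_cases ha : a ∈ C
    · obtain ⟨h1, h2, h3⟩ := hσs _ ha
      simp only [hF1, hF2, ha, if_true]
      exact fixed_lintegral (Matrix.of a) K (σ a) t hK (hCP _ ha).1 h1 h2 h3 k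
    · simp [hF1, hF2, ha]
  simp only [key]
  rw [lintegral_const_mul' _ _ ENNReal.ofReal_ne_top, ENNReal.toReal_mul,
    ENNReal.toReal_ofReal (by positivity)]
end
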